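/- Let n ≥ 5 and let A be an n×n (−1,1)-matrix whose rank over ℚ equals r+1 for some integer 0 ≤ r ≤ n−1. Then |per A| = per D_{(n,r)} if and only if A can be obtained from D_{(n,r)} by standard transformations. -/

import Mathlib

open Matrix

/-- The permanent of a square matrix. -/
def per {n : ℕ} (A : Matrix (Fin n) (Fin n) ℚ) : ℚ :=
  ∑ σ : Equiv.Perm (Fin n), ∏ i, A i (σ i)

/-- The square matrix `D_{(n,l)}`: `-1` on the first `l` diagonal entries, `1` elsewhere. -/
def Dmat (n l : ℕ) : Matrix (Fin n) (Fin n) ℚ :=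
  fun i j => if (i : ℕ) = (j : ℕ) ∧ (j : ℕ) < l then -1 else 1

/-- `A` is obtained from `B` by standard transformations: a finite composition of row
permutations, column permutations, multiplications of rows/columns by `-1`, and
transposition (square case). -/
def StdEquiv {n : ℕ} (A B : Matrix (Fin n) (Fin n) ℚ) : Prop :=
  ∃ (ρ σ : Equiv.Perm (Fin n)) (ε δ : Fin n → ℚ),
    (∀ i, ε i = 1 ∨ ε i = -1) ∧ (∀ j, δ j = 1 ∨ δ j = -1) ∧
    ((∀ i j, A i j = ε i * δ j * B (ρ i) (σ j)) ∨
     (∀ i j, A i j = ε i * δ j * B (σ j) (ρ i)))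

/-! ### Permanents -/

section Permanent

variable {n : ℕ}

theorem per_submatrix (ρ σ : Equiv.Perm (Fin n)) (A : Matrix (Fin n) (Fin n) ℚ) :
    per (A.submatrix ρ σ) = per A := by
  unfold per
  refine Fintype.sum_equiv ((Equiv.permCongr ρ).trans (Equiv.mulLeft (σ * ρ⁻¹))) _ _ fun τ => ?_
  refine Fintype.prod_equiv ρ _ _ fun i => ?_
  simp

theorem per_transpose (A : Matrix (Fin n) (Fin n) ℚ) : per Aᵀ = per A := by
  unfold per
  refine Fintype.sum_equiv (Equiv.inv _) _ _ fun τ => ?_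
  refine Fintype.prod_equiv τ _ _ fun i => ?_
  simp

theorem per_scale (ε δ : Fin n → ℚ) (A : Matrix (Fin n) (Fin n) ℚ) :
    per (fun i j => ε i * δ j * A i j) = (∏ i, ε i) * (∏ j, δ j) * per A := by
  unfold per
  rw [Finset.mul_sum]
  refine Finset.sum_congr rfl fun τ _ => ?_
  rw [Finset.prod_mul_distrib, Finset.prod_mul_distrib, Equiv.prod_comp τ δ]

theorem per_succ_row (A : Matrix (Fin (n + 1)) (Fin (n + 1)) ℚ) :
    per A = ∑ j, A 0 j * per (A.submatrix Fin.succ j.succAbove) := by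
  have key : ∀ j : Fin (n + 1), per (A.submatrix Fin.succ j.succAbove) =
      per (A.submatrix Fin.succ fun x => Equiv.swap 0 j x.succ) := by
    intro j
    refine Fin.cases ?_ (fun i => ?_) j
    · congr 1
    · cases n with
      | zero => exact i.elim0
      | succ n =>
        rw [← per_submatrix 1 i.cycleRange]
        congr 1
        ext a b
        simp [Fin.succAbove_cycleRange]
  simp_rw [key]
  conv_lhs => unfold per
  rw [← Equiv.sum_comp Equiv.Perm.decomposeFin.symm, Fintype.sum_prod_type]
  refine Finset.sum_congr rfl fun j _ => ?_
  unfold per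
  rw [Finset.mul_sum]
  refine Finset.sum_congr rfl fun τ _ => ?_
  rw [Fin.prod_univ_succ]
  simp

end Permanent

/-! ### The extremal values -/

/-- The value of `per D_{(n,r)}`, given by its recurrence in `r`. -/
def kval : ℕ → ℕ → ℚ
  | n, 0 => (n.factorial : ℚ)
  | 0, _ + 1 => 0
  | n + 1, r + 1 => kval (n + 1) r - 2 * kval n r

theorem kval_zero (n : ℕ) : kval n 0 = (n.factorial : ℚ) := by cases n <;> rfl

theorem kval_succ (n r : ℕ) : kval (n + 1) (r + 1) = kval (n + 1) r - 2 * kval n r := rfl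

theorem kval_expand (n r : ℕ) (h : r ≤ n) :
    kval (n + 1) r = ((n : ℚ) + 1 - r) * kval n r + r * kval n (r - 1) := by
  induction n generalizing r with
  | zero =>
    obtain rfl : r = 0 := by omega
    simp [kval]
  | succ n ihn =>
    induction r with
    | zero =>
      rw [kval_zero, kval_zero, Nat.factorial_succ]
      push_cast
      ring
    | succ r ihr =>
      have e1 := ihr (by omega)
      have e2 := ihn r (by omega)
      rw [kval_succ, e1, kval_succ n r, Nat.add_sub_cancel]
      rcases r with _ | r
      · push_cast at *
        linear_combination -2 * e2
      · rw [Nat.add_sub_cancel] at *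
        have e3 := kval_succ n r
        push_cast at *
        linear_combination -2 * e2 - (r + 1 : ℚ) * e3

theorem kval_full (n : ℕ) : kval (n + 3) (n + 2) = ((n : ℚ) + 1) * kval (n + 2) n := by
  have e1 := kval_expand (n + 2) (n + 2) le_rfl
  have e2 := kval_expand (n + 1) (n + 1) le_rfl
  have e3 := kval_succ (n + 1) (n + 1)
  have e4 := kval_succ (n + 1) n
  simp only [Nat.add_sub_cancel, show n + 2 - 1 = n + 1 by omega] at *
  push_cast at *
  linear_combination e1 + e3 + 2 * e2 + (n + 1 : ℚ) * e4

theorem kval_pos (n r : ℕ) (hn : 3 ≤ n) (hr : r + 1 ≤ n) : 0 < kval n r := by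
  induction n, hn using Nat.le_induction generalizing r with
  | base =>
    have : r = 0 ∨ r = 1 ∨ r = 2 := by omega
    rcases this with rfl | rfl | rfl <;> norm_num [kval, Nat.factorial]
  | succ n hn ih =>
    rcases Nat.lt_or_ge r n with h | h
    · rw [kval_expand n r h.le]
      have h1 := ih r h
      have h2 := ih (r - 1) (by omega)
      have h3 : (0 : ℚ) < (n : ℚ) + 1 - r := by
        have : (r : ℚ) < n := by exact_mod_cast h
        linarith
      positivity
    · obtain rfl : r = n := by omega
      obtain ⟨k, rfl⟩ : ∃ k, r = k + 2 := ⟨r - 2, by omega⟩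
      rw [kval_full]
      have := ih k (by omega)
      positivity

theorem kval_lt (n r : ℕ) (hn : 4 ≤ n) (hr : r + 2 ≤ n) : kval n (r + 1) < kval n r := by
  obtain ⟨k, rfl⟩ : ∃ k, n = k + 1 := ⟨n - 1, by omega⟩
  have := kval_pos k r (by omega) (by omega)
  rw [kval_succ]
  linarith

theorem kval_anti (n r s : ℕ) (hn : 3 ≤ n) (hrs : r ≤ s) (hs : s + 1 ≤ n) :
    kval n s ≤ kval n r := by
  induction s, hrs using Nat.le_induction with
  | base => exact le_rfl
  | succ s h ih =>
    refine le_trans ?_ (ih (by omega))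
    rcases Nat.lt_or_ge n 4 with h4 | h4
    · obtain rfl : n = 3 := by omega
      have : s = 0 ∨ s = 1 := by omega
      rcases this with rfl | rfl <;> norm_num [kval, Nat.factorial]
    · exact (kval_lt n s h4 (by omega)).le

/-! ### Star matrices -/

/-- The matrix with `-1` at the positions `(i, g i)` for `i ∈ T` and `1` elsewhere. -/
def starMat {m n : ℕ} (T : Finset (Fin m)) (g : Fin m → Fin n) : Matrix (Fin m) (Fin n) ℚ :=
  fun i j => if i ∈ T ∧ g i = j then -1 else 1

/-- All entries are `1` or `-1`. -/
def IsSign {α β : Type*} (A : Matrix α β ℚ) : Prop := ∀ i j, A i j = 1 ∨ A i j = -1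

/-- All values are `1` or `-1`. -/
def IsSignVec {α : Type*} (v : α → ℚ) : Prop := ∀ i, v i = 1 ∨ v i = -1

/-- Up to signs and permutations of the rows and columns, `A` is `1` everywhere except for `-1`
at `r` positions in pairwise different rows and columns. -/
def IsStar {m n : ℕ} (r : ℕ) (A : Matrix (Fin m) (Fin n) ℚ) : Prop :=
  ∃ (T : Finset (Fin m)) (g : Fin m → Fin n) (ε : Fin m → ℚ) (δ : Fin n → ℚ),
    T.card = r ∧ Set.InjOn g T ∧ IsSignVec ε ∧ IsSignVec δ ∧
      ∀ i j, A i j = ε i * δ j * starMat T g i j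

theorem starMat_eq_submatrix {n : ℕ} (T : Finset (Fin n)) (g : Fin n → Fin n)
    (hg : Set.InjOn g T) :
    ∃ ρ σ : Equiv.Perm (Fin n), starMat T g = (Dmat n T.card).submatrix ρ σ := by
  obtain ⟨τ, hτ⟩ : ∃ τ : Equiv.Perm (Fin n), ∀ i ∈ T, τ i = g i := by
    obtain ⟨τ, hτ⟩ := Finset.exists_equiv_extend_of_card_eq (t := Finset.univ)
      (by simp : Fintype.card (Fin n) = (Finset.univ : Finset (Fin n)).card)
      (Finset.subset_univ (T.image g)) hg
    exact ⟨τ.trans (Equiv.subtypeUnivEquiv (by simp)), fun i hi => by simpa using hτ i hi⟩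
  have hcard : T.card ≤ n := by simpa using Finset.card_le_univ T
  obtain ⟨ρ, hρ⟩ : ∃ ρ : Equiv.Perm (Fin n), ∀ i, i ∈ T ↔ ((ρ i : Fin n) : ℕ) < T.card := by
    have e : {i // i ∈ T} ≃ {i : Fin n // (i : ℕ) < T.card} := Fintype.equivOfCardEq (by
      rw [Fintype.card_coe, Fintype.card_subtype]
      have : (Finset.univ.filter fun i : Fin n => (i : ℕ) < T.card).card = T.card := by
        rw [Fin.card_filter_val_lt]
        omega
      exact this.symm)
    refine ⟨e.extendSubtype, fun i => ⟨fun hi => ?_, fun hi => ?_⟩⟩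
    · exact e.extendSubtype_mem i hi
    · by_contra h
      exact e.extendSubtype_not_mem i h hi
  refine ⟨ρ, τ.symm.trans ρ, ?_⟩
  ext i j
  simp only [starMat, Dmat, submatrix_apply, Equiv.trans_apply]
  refine if_congr ⟨fun ⟨h1, h2⟩ => ?_, fun ⟨h1, h2⟩ => ?_⟩ rfl rfl
  · rw [← h2, ← hτ i h1, Equiv.symm_apply_apply]
    exact ⟨rfl, (hρ i).1 h1⟩
  · have h3 : i ∈ T := (hρ i).2 (by omega)
    refine ⟨h3, ?_⟩
    have : i = τ.symm j := ρ.injective (Fin.ext h1)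
    rw [← hτ i h3, this, Equiv.apply_symm_apply]

theorem per_Dmat (n r : ℕ) (h : r ≤ n) : per (Dmat n r) = kval n r := by
  induction r generalizing n with
  | zero =>
    rw [kval_zero]
    simp [per, Dmat, Fintype.card_perm]
  | succ r ih =>
    obtain ⟨m, rfl⟩ : ∃ m, n = m + 1 := ⟨n - 1, by omega⟩
    rw [kval_succ, ← ih (m + 1) (by omega), ← ih m (by omega)]
    set T : Finset (Fin (m + 1)) := Finset.univ.filter fun i => (i : ℕ) < r + 1 ∧ i ≠ 0
    have hT : T.card = r := by
      have : T = (Finset.univ.filter fun i : Fin (m + 1) => (i : ℕ) < r + 1).erase 0 := by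
        ext i
        simp [T, and_comm]
      rw [this, Finset.card_erase_of_mem (by simp), Fin.card_filter_val_lt]
      omega
    have e1 : per (Dmat (m + 1) r) = per (starMat T id) := by
      obtain ⟨ρ, σ, h'⟩ := starMat_eq_submatrix T id (Function.injective_id.injOn)
      rw [h', per_submatrix, hT]
    have e2 : ∀ j : Fin (m + 1), (starMat T id).submatrix Fin.succ j.succAbove =
        (Dmat (m + 1) (r + 1)).submatrix Fin.succ j.succAbove := by
      intro j
      ext a b
      simp only [starMat, Dmat, submatrix_apply, T, Finset.mem_filter, Finset.mem_univ, true_and,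
        id]
      refine if_congr ⟨?_, ?_⟩ rfl rfl
      · rintro ⟨⟨h1, _⟩, h2⟩
        rw [← h2]
        exact ⟨rfl, h1⟩
      · rintro ⟨h1, h2⟩
        exact ⟨⟨by omega, Fin.succ_ne_zero _⟩, Fin.ext h1⟩
    have e3 : (Dmat (m + 1) (r + 1)).submatrix Fin.succ (Fin.succAbove 0) = Dmat m r := by
      ext a b
      simp [Dmat]
    rw [e1, per_succ_row (Dmat _ _), per_succ_row (starMat _ _)]
    simp_rw [e2]
    rw [Fin.sum_univ_succ, Fin.sum_univ_succ, e3]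
    simp [Dmat, starMat, T]
    ring

theorem per_starMat {n : ℕ} (T : Finset (Fin n)) (g : Fin n → Fin n) (hg : Set.InjOn g T) :
    per (starMat T g) = kval n T.card := by
  obtain ⟨ρ, σ, h⟩ := starMat_eq_submatrix T g hg
  rw [h, per_submatrix, per_Dmat]
  simpa using Finset.card_le_univ T

theorem IsSignVec.prod_abs {α : Type*} [Fintype α] {v : α → ℚ} (h : IsSignVec v) :
    |∏ i, v i| = 1 := by
  rw [Finset.abs_prod]
  refine Finset.prod_eq_one fun i _ => ?_
  rcases h i with h | h <;> simp [h]

theorem abs_per_scale {n : ℕ} {ε δ : Fin n → ℚ} (hε : IsSignVec ε) (hδ : IsSignVec δ)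
    (A : Matrix (Fin n) (Fin n) ℚ) : |per (fun i j => ε i * δ j * A i j)| = |per A| := by
  rw [per_scale, abs_mul, abs_mul, hε.prod_abs, hδ.prod_abs]
  ring

theorem IsStar.stdEquiv {n r : ℕ} {A : Matrix (Fin n) (Fin n) ℚ} (h : IsStar r A) :
    StdEquiv A (Dmat n r) := by
  obtain ⟨T, g, ε, δ, rfl, hg, hε, hδ, hA⟩ := h
  obtain ⟨ρ, σ, h⟩ := starMat_eq_submatrix T g hg
  refine ⟨ρ, σ, ε, δ, hε, hδ, Or.inl fun i j => ?_⟩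
  rw [hA, h, submatrix_apply]

theorem StdEquiv.abs_per {n : ℕ} {A B : Matrix (Fin n) (Fin n) ℚ} (h : StdEquiv A B) :
    |per A| = |per B| := by
  obtain ⟨ρ, σ, ε, δ, hε, hδ, h | h⟩ := h
  · have : A = fun i j => ε i * δ j * B.submatrix ρ σ i j := by ext i j; exact h i j
    rw [this, abs_per_scale hε hδ, per_submatrix]
  · have : A = fun i j => ε i * δ j * (Bᵀ).submatrix ρ σ i j := by ext i j; exact h i j
    rw [this, abs_per_scale hε hδ, per_submatrix, per_transpose]

/-! ### Parallel vectors -/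

/-- `u` and `v` agree up to a common sign. -/
def Par {α : Type*} (u v : α → ℚ) : Prop := ∃ s : ℚ, (s = 1 ∨ s = -1) ∧ ∀ i, u i = s * v i

section Par

variable {α : Type*} {u v w : α → ℚ}

theorem Par.refl (u : α → ℚ) : Par u u := ⟨1, Or.inl rfl, by simp⟩

theorem Par.symm (h : Par u v) : Par v u := by
  obtain ⟨s, hs, h⟩ := h
  refine ⟨s, hs, fun i => ?_⟩
  rcases hs with rfl | rfl <;> simp [h]

theorem Par.trans (h : Par u v) (h' : Par v w) : Par u w := by
  obtain ⟨s, hs, h⟩ := h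
  obtain ⟨t, ht, h'⟩ := h'
  refine ⟨s * t, ?_, fun i => by rw [h, h', mul_assoc]⟩
  rcases hs with rfl | rfl <;> rcases ht with rfl | rfl <;> simp

theorem eq_or_eq_neg_of_sign {x y : ℚ} (hx : x = 1 ∨ x = -1) (hy : y = 1 ∨ y = -1) :
    x = y ∨ x = -y := by
  rcases hx with rfl | rfl <;> rcases hy with rfl | rfl <;> simp

theorem exists_of_not_par (hu : IsSignVec u) (hv : IsSignVec v) (h : ¬ Par u v) :
    (∃ i, u i = v i) ∧ ∃ i, u i = -v i := by
  constructor
  · by_contra! h'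
    refine h ⟨-1, Or.inr rfl, fun i => ?_⟩
    rcases eq_or_eq_neg_of_sign (hu i) (hv i) with h1 | h1
    · exact absurd h1 (h' i)
    · simp [h1]
  · by_contra! h'
    refine h ⟨1, Or.inl rfl, fun i => ?_⟩
    rcases eq_or_eq_neg_of_sign (hu i) (hv i) with h1 | h1
    · simp [h1]
    · exact absurd h1 (h' i)

end Par

/-! ### Ranks and coloops -/

section Rank

open Module Submodule

variable {m n : ℕ}

/-- Column `j` is not in the span of the other columns. -/
def Coloop (R : Matrix (Fin m) (Fin n) ℚ) (j : Fin n) : Prop :=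
  R.col j ∉ span ℚ (R.col '' {j}ᶜ)

theorem finrank_span_insert_le {V : Type*} [AddCommGroup V] [Module ℚ V] [FiniteDimensional ℚ V]
    (x : V) (s : Set V) : finrank ℚ (span ℚ (insert x s)) ≤ finrank ℚ (span ℚ s) + 1 := by
  rw [span_insert]
  refine (finrank_add_le_finrank_add_finrank _ _).trans ?_
  have : finrank ℚ (span ℚ {x}) ≤ 1 := by
    simpa using finrank_span_le_card (R := ℚ) ({x} : Set V)
  omega

theorem finrank_span_insert_of_notMem {V : Type*} [AddCommGroup V] [Module ℚ V]
    [FiniteDimensional ℚ V] {x : V} {s : Set V} (h : x ∉ span ℚ s) :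
    finrank ℚ (span ℚ (insert x s)) = finrank ℚ (span ℚ s) + 1 := by
  refine le_antisymm (finrank_span_insert_le x s) ?_
  refine Submodule.finrank_lt_finrank_of_lt ?_
  refine lt_of_le_of_ne (span_mono (Set.subset_insert _ _)) fun h' => h ?_
  rw [h']
  exact subset_span (Set.mem_insert _ _)

theorem finrank_span_cols (R : Matrix (Fin m) (Fin n) ℚ) :
    finrank ℚ (span ℚ (R.col '' Set.univ)) = R.rank := by
  rw [Set.image_univ, rank_eq_finrank_span_cols]

theorem image_col_univ (R : Matrix (Fin m) (Fin n) ℚ) (j : Fin n) :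
    R.col '' Set.univ = insert (R.col j) (R.col '' {j}ᶜ) := by
  rw [← Set.image_insert_eq]
  congr 1
  ext k
  simp [em]

theorem rank_deleteCol (R : Matrix (Fin m) (Fin (n + 1)) ℚ) (j : Fin (n + 1)) :
    (R.submatrix id j.succAbove).rank = finrank ℚ (span ℚ (R.col '' {j}ᶜ)) := by
  rw [rank_eq_finrank_span_cols, ← Fin.range_succAbove, ← Set.range_comp]
  rfl

theorem Coloop.rank_deleteCol {R : Matrix (Fin m) (Fin (n + 1)) ℚ} {j : Fin (n + 1)}
    (h : Coloop R j) : (R.submatrix id j.succAbove).rank + 1 = R.rank := by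
  rw [_root_.rank_deleteCol, ← finrank_span_cols R, image_col_univ R j,
    finrank_span_insert_of_notMem h]

theorem rank_deleteCol_of_not_coloop {R : Matrix (Fin m) (Fin (n + 1)) ℚ} {j : Fin (n + 1)}
    (h : ¬ Coloop R j) : (R.submatrix id j.succAbove).rank = R.rank := by
  rw [_root_.rank_deleteCol, ← finrank_span_cols R, image_col_univ R j,
    span_insert_eq_span (not_not.1 h)]

theorem rank_le_rank_deleteCol (R : Matrix (Fin m) (Fin (n + 1)) ℚ) (j : Fin (n + 1)) :
    R.rank ≤ (R.submatrix id j.succAbove).rank + 1 := by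
  by_cases h : Coloop R j
  · exact h.rank_deleteCol.ge
  · rw [rank_deleteCol_of_not_coloop h]
    omega

theorem rank_le_rank_deleteRow (A : Matrix (Fin (m + 1)) (Fin n) ℚ) :
    A.rank ≤ (A.submatrix Fin.succ id).rank + 1 := by
  have := rank_le_rank_deleteCol Aᵀ 0
  rwa [rank_transpose, ← transpose_submatrix, rank_transpose, Fin.succAbove_zero] at this

theorem rank_eq_card_add (R : Matrix (Fin m) (Fin n) ℚ) (Z : Finset (Fin n))
    (hZ : ∀ j ∈ Z, Coloop R j) :
    R.rank = Z.card + finrank ℚ (span ℚ (R.col '' (Z : Set (Fin n))ᶜ)) := by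
  induction Z using Finset.induction_on with
  | empty =>
    rw [← finrank_span_cols R, Finset.coe_empty, Set.compl_empty, Finset.card_empty, zero_add]
  | insert j Z hj ih =>
    rw [ih fun k hk => hZ k (Finset.mem_insert_of_mem hk), Finset.card_insert_of_notMem hj]
    have e : ((Z : Set (Fin n))ᶜ) = insert j (((insert j Z : Finset (Fin n)) : Set (Fin n))ᶜ) := by
      ext k
      by_cases h : k = j <;> simp [h, hj]
    have h2 : R.col j ∉
        span ℚ (R.col '' ((insert j Z : Finset (Fin n)) : Set (Fin n))ᶜ) := fun h' =>
      hZ j (Finset.mem_insert_self _ _) (span_mono (Set.image_mono (by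
        intro k hk
        simp at hk ⊢
        exact hk.1)) h')
    rw [e, Set.image_insert_eq, finrank_span_insert_of_notMem h2]
    omega

theorem IsSign.finrank_pos {R : Matrix (Fin m) (Fin n) ℚ} (hR : IsSign R) (hm : 0 < m)
    {S : Set (Fin n)} {j : Fin n} (hj : j ∈ S) : 0 < finrank ℚ (span ℚ (R.col '' S)) := by
  have h0 : R.col j ≠ 0 := by
    intro h
    have h1 := congrFun h ⟨0, hm⟩
    have h2 := hR ⟨0, hm⟩ j
    simp [Matrix.col_apply] at h1
    rcases h2 with h2 | h2 <;> rw [h1] at h2 <;> norm_num at h2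
  rw [finrank_pos_iff]
  exact ⟨⟨⟨R.col j, subset_span ⟨j, hj, rfl⟩⟩, 0, fun h => h0 (congrArg Subtype.val h)⟩⟩

theorem IsSign.par_of_finrank_le_one {R : Matrix (Fin m) (Fin n) ℚ} (hR : IsSign R) (hm : 0 < m)
    {S : Set (Fin n)} (hS : finrank ℚ (span ℚ (R.col '' S)) ≤ 1) {j k : Fin n} (hj : j ∈ S)
    (hk : k ∈ S) : Par (Rᵀ j) (Rᵀ k) := by
  obtain ⟨v, hv⟩ := finrank_le_one_iff.1 hS
  obtain ⟨a, ha⟩ := hv ⟨R.col j, subset_span ⟨j, hj, rfl⟩⟩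
  obtain ⟨b, hb⟩ := hv ⟨R.col k, subset_span ⟨k, hk, rfl⟩⟩
  have ha' : ∀ i, a * v.1 i = R i j := fun i => congrFun (congrArg Subtype.val ha) i
  have hb' : ∀ i, b * v.1 i = R i k := fun i => congrFun (congrArg Subtype.val hb) i
  have hab : a = b ∨ a = -b := by
    have h1 := ha' ⟨0, hm⟩
    have h2 := hb' ⟨0, hm⟩
    have hx : v.1 ⟨0, hm⟩ ≠ 0 := by
      intro h
      rw [h, mul_zero] at h1
      rcases hR ⟨0, hm⟩ j with h3 | h3 <;> rw [← h1] at h3 <;> norm_num at h3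
    rcases eq_or_eq_neg_of_sign (hR ⟨0, hm⟩ j) (hR ⟨0, hm⟩ k) with h | h
    · left
      exact mul_right_cancel₀ hx (by rw [h1, h2, h])
    · right
      exact mul_right_cancel₀ hx (by rw [h1, neg_mul, h2, h])
  rcases hab with rfl | rfl
  · exact ⟨1, Or.inl rfl, fun i => by simp [← ha', ← hb']⟩
  · exact ⟨-1, Or.inr rfl, fun i => by simp [← ha', ← hb']⟩

theorem not_coloop_of_par {R : Matrix (Fin m) (Fin n) ℚ} {j k : Fin n} (hjk : j ≠ k)
    (h : Par (Rᵀ j) (Rᵀ k)) : ¬ Coloop R j := by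
  obtain ⟨s, -, h⟩ := h
  rw [Coloop, not_not]
  have : R.col j = s • R.col k := funext h
  rw [this]
  exact smul_mem _ _ (subset_span ⟨k, hjk.symm, rfl⟩)

theorem exists_not_coloop_of_rank_lt {R : Matrix (Fin m) (Fin n) ℚ} (h : R.rank < n) :
    ∃ j, ¬ Coloop R j := by
  by_contra! h'
  have := rank_eq_card_add R Finset.univ fun j _ => h' j
  simp at this
  omega

theorem rank_le_card_of_par (A : Matrix (Fin m) (Fin n) ℚ) (S : Finset (Fin m))
    (h : ∀ i, ∃ s ∈ S, Par (A i) (A s)) : A.rank ≤ S.card := by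
  rw [rank_eq_finrank_span_row]
  have h1 : span ℚ (Set.range A.row) ≤ span ℚ ((S.image A : Finset (Fin n → ℚ)) : Set _) := by
    rw [span_le]
    rintro _ ⟨i, rfl⟩
    obtain ⟨s, hs, c, -, hc⟩ := h i
    have : A.row i = c • A s := funext hc
    rw [this]
    exact smul_mem _ _ (subset_span (Finset.mem_coe.2 (Finset.mem_image_of_mem A hs)))
  refine (Submodule.finrank_mono h1).trans ?_
  exact (finrank_span_finset_le_card _).trans Finset.card_image_le

theorem rank_eq_three {R : Matrix (Fin 3) (Fin n) ℚ} (hR : IsSign R)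
    (h : ∀ i j, i ≠ j → ¬ Par (R i) (R j)) : R.rank = 3 := by
  have hli : LinearIndependent ℚ R.row := by
    rw [Fintype.linearIndependent_iff]
    intro c hc
    have e : ∀ j, c 0 * R 0 j + c 1 * R 1 j + c 2 * R 2 j = 0 := fun j => by
      have := congrFun hc j
      simpa [Fin.sum_univ_three] using this
    have sq : ∀ i j, R i j ^ 2 = 1 := fun i j => by rcases hR i j with h | h <;> simp [h]
    have key : c 0 * c 1 = 0 ∧ c 0 * c 2 = 0 ∧ c 1 * c 2 = 0 := by
      refine ⟨?_, ?_, ?_⟩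
      · obtain ⟨⟨j, hj⟩, ⟨k, hk⟩⟩ := exists_of_not_par (hR 0) (hR 1) (h 0 1 (by decide))
        have e1 := e j
        have e2 := e k
        rw [hj] at e1
        rw [hk] at e2
        have s1 : (c 0 + c 1) ^ 2 = c 2 ^ 2 := by
          linear_combination (c 0 * R 1 j + c 1 * R 1 j - c 2 * R 2 j) * e1
            - (c 0 + c 1) ^ 2 * sq 1 j + c 2 ^ 2 * sq 2 j
        have s2 : (c 0 - c 1) ^ 2 = c 2 ^ 2 := by
          linear_combination (-c 0 * R 1 k + c 1 * R 1 k - c 2 * R 2 k) * e2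
            - (c 0 - c 1) ^ 2 * sq 1 k + c 2 ^ 2 * sq 2 k
        linarith
      · obtain ⟨⟨j, hj⟩, ⟨k, hk⟩⟩ := exists_of_not_par (hR 0) (hR 2) (h 0 2 (by decide))
        have e1 := e j
        have e2 := e k
        rw [hj] at e1
        rw [hk] at e2
        have s1 : (c 0 + c 2) ^ 2 = c 1 ^ 2 := by
          linear_combination (c 0 * R 2 j + c 2 * R 2 j - c 1 * R 1 j) * e1
            - (c 0 + c 2) ^ 2 * sq 2 j + c 1 ^ 2 * sq 1 j
        have s2 : (c 0 - c 2) ^ 2 = c 1 ^ 2 := by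
          linear_combination (-c 0 * R 2 k + c 2 * R 2 k - c 1 * R 1 k) * e2
            - (c 0 - c 2) ^ 2 * sq 2 k + c 1 ^ 2 * sq 1 k
        linarith
      · obtain ⟨⟨j, hj⟩, ⟨k, hk⟩⟩ := exists_of_not_par (hR 1) (hR 2) (h 1 2 (by decide))
        have e1 := e j
        have e2 := e k
        rw [hj] at e1
        rw [hk] at e2
        have s1 : (c 1 + c 2) ^ 2 = c 0 ^ 2 := by
          linear_combination (c 1 * R 2 j + c 2 * R 2 j - c 0 * R 0 j) * e1
            - (c 1 + c 2) ^ 2 * sq 2 j + c 0 ^ 2 * sq 0 j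
        have s2 : (c 1 - c 2) ^ 2 = c 0 ^ 2 := by
          linear_combination (-c 1 * R 2 k + c 2 * R 2 k - c 0 * R 0 k) * e2
            - (c 1 - c 2) ^ 2 * sq 2 k + c 0 ^ 2 * sq 0 k
        linarith
    obtain ⟨j, hj⟩ := (exists_of_not_par (hR 0) (hR 1) (h 0 1 (by decide))).1
    have ej := e j
    have n0 : ∀ i, R i j ≠ 0 := fun i h0 => by simpa [h0] using sq i j
    simp only [mul_eq_zero] at key
    have all : c 0 = 0 ∧ c 1 = 0 ∧ c 2 = 0 := by
      have := n0 0
      have := n0 1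
      have := n0 2
      rcases key with ⟨h1 | h1, h2 | h2, h3 | h3⟩ <;> simp_all
    intro i
    fin_cases i
    · exact all.1
    · exact all.2.1
    · exact all.2.2
  simpa using hli.rank_matrix

end Rank

/-! ### Invariance of stars -/

section Invariance

variable {m n r : ℕ}

theorem IsSign.transpose {α β : Type*} {A : Matrix α β ℚ} (h : IsSign A) : IsSign Aᵀ :=
  fun i j => h j i

theorem IsSign.submatrix {α β γ δ : Type*} {A : Matrix α β ℚ} (h : IsSign A) (f : γ → α)
    (g : δ → β) : IsSign (A.submatrix f g) := fun i j => h (f i) (g j)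

theorem IsSignVec.mul {α : Type*} {u v : α → ℚ} (hu : IsSignVec u) (hv : IsSignVec v) :
    IsSignVec (fun i => u i * v i) := fun i => by
  rcases hu i with h | h <;> rcases hv i with h' | h' <;> simp [h, h']

theorem IsSignVec.sq {α : Type*} {u : α → ℚ} (hu : IsSignVec u) (i : α) : u i * u i = 1 := by
  rcases hu i with h | h <;> simp [h]

theorem IsSign.sq {α β : Type*} {A : Matrix α β ℚ} (h : IsSign A) (i : α) (j : β) :
    A i j * A i j = 1 := by
  rcases h i j with h | h <;> simp [h]

theorem IsSign.scale {α β : Type*} {A : Matrix α β ℚ} (h : IsSign A) {ε : α → ℚ} {δ : β → ℚ}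
    (hε : IsSignVec ε) (hδ : IsSignVec δ) : IsSign (fun i j => ε i * δ j * A i j) :=
  fun i j => by
    rcases hε i with h1 | h1 <;> rcases hδ j with h2 | h2 <;> rcases h i j with h3 | h3 <;> simp [h1, h2, h3]

theorem IsStar.of_submatrix {A : Matrix (Fin m) (Fin n) ℚ} (ρ : Equiv.Perm (Fin m))
    (σ : Equiv.Perm (Fin n)) (h : IsStar r (A.submatrix ρ σ)) : IsStar r A := by
  obtain ⟨T, g, ε, δ, hT, hg, hε, hδ, hA⟩ := h
  refine ⟨T.map ρ.toEmbedding, fun i => σ (g (ρ.symm i)), fun i => ε (ρ.symm i),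
    fun j => δ (σ.symm j), by simpa, ?_, fun i => hε _, fun j => hδ _, fun i j => ?_⟩
  · intro a ha b hb hab
    simp only [Finset.coe_map, Set.mem_image, Finset.mem_coe, Equiv.coe_toEmbedding] at ha hb
    obtain ⟨a, ha, rfl⟩ := ha
    obtain ⟨b, hb, rfl⟩ := hb
    simp only [Equiv.symm_apply_apply, EmbeddingLike.apply_eq_iff_eq] at hab
    rw [hg ha hb hab]
  · have := hA (ρ.symm i) (σ.symm j)
    simp only [submatrix_apply, Equiv.apply_symm_apply] at this
    rw [this]
    congr 1
    simp only [starMat]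
    refine if_congr ?_ rfl rfl
    simp only [Finset.mem_map_equiv, Equiv.eq_symm_apply]

theorem IsStar.of_scale {A : Matrix (Fin m) (Fin n) ℚ} {ε : Fin m → ℚ} {δ : Fin n → ℚ}
    (hε : IsSignVec ε) (hδ : IsSignVec δ) (h : IsStar r (fun i j => ε i * δ j * A i j)) :
    IsStar r A := by
  obtain ⟨T, g, ε', δ', hT, hg, hε', hδ', hA⟩ := h
  refine ⟨T, g, fun i => ε i * ε' i, fun j => δ j * δ' j, hT, hg, hε.mul hε', hδ.mul hδ',
    fun i j => ?_⟩
  linear_combination (ε i * δ j) * hA i j - δ j * δ j * A i j * hε.sq i - A i j * hδ.sq j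

theorem IsStar.transpose {A : Matrix (Fin n) (Fin n) ℚ} (h : IsStar r A) : IsStar r Aᵀ := by
  obtain ⟨T, g, ε, δ, hT, hg, hε, hδ, hA⟩ := h
  rcases Nat.eq_zero_or_pos r with rfl | hr
  · obtain rfl := Finset.card_eq_zero.1 hT
    exact ⟨∅, g, δ, ε, rfl, by simp, hδ, hε, fun i j => by
      rw [transpose_apply, hA]
      simp [starMat, mul_comm]⟩
  · obtain ⟨i0, hi0⟩ : T.Nonempty := Finset.card_pos.1 (hT ▸ hr)
    have : Nonempty (Fin n) := ⟨i0⟩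
    refine ⟨T.image g, Function.invFunOn g T, δ, ε, by rw [Finset.card_image_of_injOn hg, hT],
      ?_, hδ, hε, fun i j => ?_⟩
    · intro a ha b hb hab
      rw [Finset.coe_image] at ha hb
      rw [← Function.invFunOn_eq ha, ← Function.invFunOn_eq hb, hab]
    · rw [transpose_apply, hA, mul_comm (ε j)]
      congr 1
      simp only [starMat]
      refine if_congr ⟨?_, ?_⟩ rfl rfl
      · rintro ⟨h1, rfl⟩
        exact ⟨Finset.mem_image_of_mem _ h1, hg.leftInvOn_invFunOn h1⟩
      · rintro ⟨h1, rfl⟩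
        rw [Finset.mem_image] at h1
        exact ⟨Function.invFunOn_mem h1, Function.invFunOn_eq h1⟩

theorem isStar_zero_of_par {A : Matrix (Fin m) (Fin (n + 1)) ℚ} (hA : IsSign A)
    (h : ∀ j, Par (Aᵀ j) (Aᵀ 0)) : IsStar 0 A := by
  choose s hs hA' using h
  exact ⟨∅, fun _ => 0, fun i => A i 0, s, rfl, by simp, fun i => hA i 0, hs, fun i j => by
    simpa [starMat, mul_comm] using hA' j i⟩

end Invariance

/-! ### Two-row expansion -/

section Pair

variable {m : ℕ}

theorem per_two_rows (A : Matrix (Fin (m + 2)) (Fin (m + 2)) ℚ) :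
    per A = ∑ j, ∑ k : Fin (m + 1), A 0 j * A 1 (j.succAbove k) *
      per (A.submatrix (fun i => i.succ.succ) fun i => j.succAbove (k.succAbove i)) := by
  rw [per_succ_row]
  refine Finset.sum_congr rfl fun j _ => ?_
  rw [per_succ_row, Finset.mul_sum]
  refine Finset.sum_congr rfl fun k _ => ?_
  rw [← mul_assoc]
  rfl

theorem abs_per_le_pair {A : Matrix (Fin (m + 2)) (Fin (m + 2)) ℚ} (hA : IsSign A) :
    |per A| ≤ ∑ j, ∑ k : Fin (m + 1),
      if (A 0 j = A 1 j ↔ A 0 (j.succAbove k) = A 1 (j.succAbove k)) then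
        |per (A.submatrix (fun i => i.succ.succ) fun i => j.succAbove (k.succAbove i))| else 0 := by
  have h1 := per_two_rows A
  have h2 := per_two_rows (A.submatrix (Equiv.swap 0 1) (Equiv.refl _))
  rw [per_submatrix] at h2
  have e : ∀ (j : Fin (m + 2)) (k : Fin (m + 1)),
      (A.submatrix (Equiv.swap 0 1) (Equiv.refl _)).submatrix (fun i : Fin m => i.succ.succ)
        (fun i => j.succAbove (k.succAbove i)) =
      A.submatrix (fun i => i.succ.succ) (fun i => j.succAbove (k.succAbove i)) := by
    intro j k
    ext a b
    have : Equiv.swap (0 : Fin (m + 2)) 1 a.succ.succ = a.succ.succ :=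
      Equiv.swap_apply_of_ne_of_ne (Fin.succ_ne_zero _) (by
        rw [← Fin.succ_zero_eq_one]
        exact fun h => Fin.succ_ne_zero _ (Fin.succ_injective _ h))
    simp [this]
  simp only [e] at h2
  simp only [submatrix_apply, Equiv.swap_apply_left, Equiv.swap_apply_right,
    Equiv.refl_apply] at h2
  have h3 : per A = ∑ j, ∑ k : Fin (m + 1),
      (A 0 j * A 1 (j.succAbove k) + A 1 j * A 0 (j.succAbove k)) / 2 *
      per (A.submatrix (fun i => i.succ.succ) fun i => j.succAbove (k.succAbove i)) := by
    have : per A = (per A + per A) / 2 := by ring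
    rw [this]
    nth_rw 1 [h1]
    rw [h2, ← Finset.sum_add_distrib, Finset.sum_div]
    refine Finset.sum_congr rfl fun j _ => ?_
    rw [← Finset.sum_add_distrib, Finset.sum_div]
    refine Finset.sum_congr rfl fun k _ => ?_
    ring
  rw [h3]
  refine (Finset.abs_sum_le_sum_abs _ _).trans (Finset.sum_le_sum fun j _ => ?_)
  refine (Finset.abs_sum_le_sum_abs _ _).trans (Finset.sum_le_sum fun k _ => ?_)
  rw [abs_mul]
  rcases hA 0 j with ha | ha <;> rcases hA 1 j with hb | hb <;>
    rcases hA 0 (j.succAbove k) with hc | hc <;> rcases hA 1 (j.succAbove k) with hd | hd <;>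
    rw [ha, hb, hc, hd] <;> norm_num

theorem sum_sum_succAbove {n : ℕ} (f : Fin (n + 1) → Fin (n + 1) → ℚ) :
    ∑ j, ∑ k : Fin n, f j (j.succAbove k) = ∑ j, ∑ k, f j k - ∑ j, f j j := by
  rw [← Finset.sum_sub_distrib]
  refine Finset.sum_congr rfl fun j _ => ?_
  rw [Fin.sum_univ_succAbove _ j]
  ring

theorem sum_pairs_mem {n : ℕ} (Z : Finset (Fin (n + 1))) (V : ℚ) :
    ∑ j, ∑ k : Fin n, (if j ∈ Z ∧ j.succAbove k ∈ Z then V else 0) =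
      (Z.card : ℚ) * (Z.card - 1) * V := by
  rw [sum_sum_succAbove fun j k => if j ∈ Z ∧ k ∈ Z then V else 0]
  have : ∀ j, ∑ k, (if j ∈ Z ∧ k ∈ Z then V else 0) = if j ∈ Z then Z.card * V else 0 := by
    intro j
    by_cases h : j ∈ Z <;> simp [h]
  simp only [this, and_self, Finset.sum_ite_mem, Finset.univ_inter, Finset.sum_const,
    nsmul_eq_mul]
  ring

theorem abs_per_le_of_pair {A : Matrix (Fin (m + 2)) (Fin (m + 2)) ℚ} (hA : IsSign A)
    (Z : Finset (Fin (m + 2))) {U V : ℚ} (hV : 0 ≤ V)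
    (h : ∀ (j : Fin (m + 2)) (k : Fin (m + 1)),
      |per (A.submatrix (fun i => i.succ.succ) fun i => j.succAbove (k.succAbove i))| ≤
        U + if j ∈ Z ∧ j.succAbove k ∈ Z then V else 0)
    (s t : ℕ) (hs : (Finset.univ.filter fun j => A 0 j = A 1 j).card = s)
    (ht : s + t = m + 2) :
    |per A| ≤ ((s : ℚ) * (s - 1) + t * (t - 1)) * U + (Z.card : ℚ) * (Z.card - 1) * V := by
  set S := Finset.univ.filter fun j => A 0 j = A 1 j
  have hS : ∀ j, j ∈ S ↔ A 0 j = A 1 j := fun j => by simp [S]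
  have ht' : Sᶜ.card = t := by
    rw [Finset.card_compl, Fintype.card_fin]
    omega
  refine (abs_per_le_pair hA).trans ?_
  rw [← hs, ← ht', add_mul, ← sum_pairs_mem S U, ← sum_pairs_mem Sᶜ U, ← sum_pairs_mem Z V,
    ← Finset.sum_add_distrib, ← Finset.sum_add_distrib]
  refine Finset.sum_le_sum fun j _ => ?_
  rw [← Finset.sum_add_distrib, ← Finset.sum_add_distrib]
  refine Finset.sum_le_sum fun k _ => ?_
  have := h j k
  simp only [← hS, Finset.mem_compl]
  by_cases h1 : j ∈ S <;> by_cases h2 : j.succAbove k ∈ S <;> simp only [h1, h2] <;>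
    simp <;> first | simpa using this | (split_ifs <;> simp [hV])

end Pair

/-! ### Recognising stars from their column-deleted submatrices -/

section Structure

variable {m n r : ℕ}

theorem exists_ne_ne (hm : 3 ≤ m) (a : Fin m) : ∃ b c : Fin m, b ≠ a ∧ c ≠ a ∧ b ≠ c := by
  have : 1 < (Finset.univ.erase a).card := by
    rw [Finset.card_erase_of_mem (Finset.mem_univ _), Finset.card_fin]
    omega
  obtain ⟨b, hb, c, hc, hbc⟩ := Finset.one_lt_card.1 this
  exact ⟨b, c, Finset.ne_of_mem_erase hb, Finset.ne_of_mem_erase hc, hbc⟩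

/-- In a star, the columns outside a set `W` of parallel columns of the right size are the
exceptional ones. -/
theorem IsStar.exists_exceptional {N : Matrix (Fin m) (Fin n) ℚ} (hm : 3 ≤ m) (h : IsStar r N)
    {W : Finset (Fin n)} (hW : W.card = r) (hpar : ∀ c ∉ W, ∀ d ∉ W, Par (Nᵀ c) (Nᵀ d))
    {c d : Fin n} (hc : c ∉ W) (hd : d ∉ W) (hcd : c ≠ d) {j : Fin n} (hj : j ∈ W) :
    ∃ (q : Fin m) (s : ℚ), (s = 1 ∨ s = -1) ∧
      ∀ i, N i j = s * N i c * if i = q then -1 else 1 := by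
  obtain ⟨T, g, ε, δ, hT, hg, hε, hδ, hN⟩ := h
  have hsub : T.image g ⊆ W := by
    rw [Finset.image_subset_iff]
    intro a ha
    by_contra hga
    obtain ⟨c', hc', hne⟩ : ∃ c' ∉ W, g a ≠ c' := by
      by_cases h : g a = c
      · exact ⟨d, hd, h ▸ hcd⟩
      · exact ⟨c, hc, h⟩
    obtain ⟨t, ht, hpar⟩ := hpar _ hga _ hc'
    have key : ∀ i, starMat T g i (g a) = δ (g a) * t * δ c' * starMat T g i c' := by
      intro i
      have h1 := hpar i
      simp only [transpose_apply, hN] at h1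
      linear_combination (ε i * δ (g a)) * h1 - (δ (g a) * δ (g a) * starMat T g i (g a)
        - δ (g a) * t * δ c' * starMat T g i c') * hε.sq i - starMat T g i (g a) * hδ.sq (g a)
    have h0 := key a
    simp only [starMat, ha, true_and, if_true, if_neg hne, mul_one] at h0
    have hmem : ∀ i, i ≠ a → i ∈ T ∧ g i = c' := by
      intro i hi
      have h1 := key i
      rw [← h0] at h1
      have h2 : ¬ (i ∈ T ∧ g i = g a) := fun h => hi (hg h.1 ha h.2)
      by_contra h3
      simp only [starMat, if_neg h2, if_neg h3] at h1
      norm_num at h1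
    obtain ⟨x, y, hx, hy, hxy⟩ := exists_ne_ne hm a
    exact hxy (hg (hmem x hx).1 (hmem y hy).1 ((hmem x hx).2.trans (hmem y hy).2.symm))
  have heq : T.image g = W := Finset.eq_of_subset_of_card_le hsub (by
    rw [Finset.card_image_of_injOn hg, hT, hW])
  rw [← heq, Finset.mem_image] at hj
  obtain ⟨q, hq, rfl⟩ := hj
  refine ⟨q, δ (g q) * δ c, hδ.mul (fun _ => hδ c) _, fun i => ?_⟩
  have h1 : starMat T g i c = 1 := by
    rw [starMat, if_neg]
    rintro ⟨hi, rfl⟩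
    exact hc (hsub (Finset.mem_image_of_mem g hi))
  have h2 : starMat T g i (g q) = if i = q then -1 else 1 := by
    refine if_congr ⟨fun h => hg h.1 hq h.2, ?_⟩ rfl rfl
    rintro rfl
    exact ⟨hq, rfl⟩
  rw [hN, hN, h1, h2]
  linear_combination (-ε i * δ (g q) * if i = q then -1 else 1) * hδ.sq c

theorem exists_two_notMem {α : Type*} [Fintype α] [DecidableEq α] (S : Finset α)
    (h : S.card + 2 ≤ Fintype.card α) : ∃ a b, a ∉ S ∧ b ∉ S ∧ a ≠ b := by
  have : 1 < Sᶜ.card := by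
    rw [Finset.card_compl]
    omega
  obtain ⟨a, ha, b, hb, hab⟩ := Finset.one_lt_card.1 this
  exact ⟨a, b, Finset.mem_compl.1 ha, Finset.mem_compl.1 hb, hab⟩

theorem isStar_of_exceptional {R : Matrix (Fin m) (Fin n) ℚ} (hR : IsSign R)
    {Z : Finset (Fin n)} (c : Fin n) {q : Fin n → Fin m} {s : Fin n → ℚ} (hs : IsSignVec s)
    (h : ∀ j i, R i j = s j * R i c * if j ∈ Z ∧ i = q j then -1 else 1)
    (hZ : ∀ a ∈ Z, ∀ b ∈ Z, a ≠ b → ¬ Par (Rᵀ a) (Rᵀ b)) : IsStar Z.card R := by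
  have hq : Set.InjOn q Z := by
    intro a ha b hb hab
    by_contra hne
    refine hZ a ha b hb hne ⟨s a * s b, hs.mul (fun _ => hs b) a, fun i => ?_⟩
    rw [Finset.mem_coe] at ha hb
    simp only [transpose_apply]
    rw [h a i, h b i]
    simp only [ha, hb, true_and, hab]
    linear_combination (-s a * R i c * if i = q b then -1 else 1) * hs.sq b
  have : Nonempty (Fin n) := ⟨c⟩
  refine ⟨Z.image q, Function.invFunOn q Z, fun i => R i c, s, Finset.card_image_of_injOn hq, ?_,
    fun i => hR i c, hs, fun i j => ?_⟩
  · intro a ha b hb hab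
    rw [Finset.coe_image] at ha hb
    rw [← Function.invFunOn_eq ha, ← Function.invFunOn_eq hb, hab]
  · rw [h, mul_comm (s j)]
    congr 1
    simp only [starMat]
    refine if_congr ⟨?_, ?_⟩ rfl rfl
    · rintro ⟨h1, rfl⟩
      exact ⟨Finset.mem_image_of_mem _ h1, hq.leftInvOn_invFunOn h1⟩
    · rintro ⟨h1, rfl⟩
      rw [Finset.mem_image] at h1
      exact ⟨Function.invFunOn_mem h1, (Function.invFunOn_eq h1).symm⟩

theorem isStar_of_deleteCol {R : Matrix (Fin m) (Fin (n + 1)) ℚ} (hR : IsSign R) (hm : 3 ≤ m)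
    {Z : Finset (Fin (n + 1))} (hZ : ∀ j ∈ Z, Coloop R j) (hcard : Z.card ≤ n)
    (hpar : ∀ c ∉ Z, ∀ d ∉ Z, Par (Rᵀ c) (Rᵀ d))
    (hex : ∀ j ∈ Z, ∃ k, k ≠ j ∧ (insert k Z).card + 2 ≤ n + 1 ∧
      ((∃ c d, c ≠ d ∧ Par ((R.submatrix id k.succAbove)ᵀ c) ((R.submatrix id k.succAbove)ᵀ d)) →
        IsStar (Z.erase k).card (R.submatrix id k.succAbove))) :
    IsStar Z.card R := by
  classical
  obtain ⟨c, hc⟩ : ∃ c, c ∉ Z := by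
    by_contra! h
    rw [(Finset.eq_univ_iff_forall.2 h), Finset.card_fin] at hcard
    omega
  have hexc : ∀ j, ∃ (q : Fin m) (s : ℚ), (s = 1 ∨ s = -1) ∧
      ∀ i, R i j = s * R i c * if j ∈ Z ∧ i = q then -1 else 1 := by
    intro j
    by_cases hj : j ∈ Z
    · obtain ⟨k, hkj, hk, hst⟩ := hex j hj
      obtain ⟨a, b, ha, hb, hab⟩ := exists_two_notMem (insert k Z) (by simpa using hk)
      simp only [Finset.mem_insert, not_or] at ha hb
      obtain ⟨a, rfl⟩ := Fin.exists_succAbove_eq ha.1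
      obtain ⟨b, rfl⟩ := Fin.exists_succAbove_eq hb.1
      obtain ⟨j, rfl⟩ := Fin.exists_succAbove_eq hkj.symm
      set W : Finset (Fin n) := Finset.univ.filter fun x => k.succAbove x ∈ Z
      have hWm : ∀ x, x ∈ W ↔ k.succAbove x ∈ Z := fun x => by simp [W]
      have hW : W.card = (Z.erase k).card := by
        rw [← Finset.card_map k.succAboveEmb]
        congr 1
        ext x
        simp only [Finset.mem_map, Finset.mem_erase, hWm, Fin.coe_succAboveEmb]
        constructor
        · rintro ⟨y, hy, rfl⟩
          exact ⟨Fin.succAbove_ne _ _, hy⟩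
        · rintro ⟨hx, hx'⟩
          obtain ⟨y, rfl⟩ := Fin.exists_succAbove_eq hx
          exact ⟨y, hx', rfl⟩
      have hab' : a ≠ b := fun h => hab (h ▸ rfl)
      obtain ⟨q, s, hs, h⟩ := (hst ⟨a, b, hab', hpar _ ha.2 _ hb.2⟩).exists_exceptional hm hW
        (fun x hx y hy => hpar _ (fun h => hx ((hWm x).2 h)) _ fun h => hy ((hWm y).2 h))
        (fun h => ha.2 ((hWm a).1 h)) (fun h => hb.2 ((hWm b).1 h)) hab' ((hWm j).2 hj)
      obtain ⟨t, ht, h'⟩ := hpar _ ha.2 _ hc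
      refine ⟨q, s * t, IsSignVec.mul (fun _ : Unit => hs) (fun _ => ht) (), fun i => ?_⟩
      have h1 := h i
      have h2 := h' i
      simp only [submatrix_apply, id] at h1
      simp only [transpose_apply] at h2
      rw [h1, h2]
      simp only [hj, true_and]
      ring
    · obtain ⟨s, hs, h⟩ := hpar _ hj _ hc
      refine ⟨⟨0, by omega⟩, s, hs, fun i => ?_⟩
      simpa [hj] using h i
  choose q s hs h using hexc
  exact isStar_of_exceptional hR c hs h fun a ha b _ hab hp => not_coloop_of_par hab hp (hZ a ha)

theorem starMat_deleteCol (T : Finset (Fin m)) (g : Fin m → Fin (n + 2)) (j : Fin (n + 2)) :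
    ∃ g' : Fin m → Fin (n + 1), (∀ i, g i ≠ j → j.succAbove (g' i) = g i) ∧
      (starMat T g).submatrix id j.succAbove = starMat (T.filter fun i => g i ≠ j) g' := by
  have : ∀ i, ∃ x : Fin (n + 1), g i ≠ j → j.succAbove x = g i := by
    intro i
    by_cases h : g i = j
    · exact ⟨0, fun h' => absurd h h'⟩
    · obtain ⟨x, hx⟩ := Fin.exists_succAbove_eq h
      exact ⟨x, fun _ => hx⟩
  choose g' hg' using this
  refine ⟨g', hg', ?_⟩
  ext i k
  simp only [submatrix_apply, starMat, id, Finset.mem_filter]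
  refine if_congr ⟨?_, ?_⟩ rfl rfl
  · rintro ⟨h1, h2⟩
    have h3 : g i ≠ j := h2 ▸ Fin.succAbove_ne _ _
    exact ⟨⟨h1, h3⟩, Fin.succAbove_right_injective (by rw [hg' i h3, h2])⟩
  · rintro ⟨⟨h1, h2⟩, rfl⟩
    exact ⟨h1, (hg' i h2).symm⟩

theorem per_starMat_deleteCol (T : Finset (Fin (n + 1))) (g : Fin (n + 1) → Fin (n + 2))
    (hg : Set.InjOn g T) (j : Fin (n + 2)) :
    per ((starMat T g).submatrix id j.succAbove) =
      kval (n + 1) (if j ∈ T.image g then T.card - 1 else T.card) := by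
  obtain ⟨g', hg', h⟩ := starMat_deleteCol T g j
  rw [h, per_starMat]
  · congr 1
    split_ifs with hj
    · obtain ⟨a, ha, rfl⟩ := Finset.mem_image.1 hj
      rw [← Finset.card_erase_of_mem ha]
      congr 1
      ext i
      simp only [Finset.mem_filter, Finset.mem_erase]
      constructor
      · rintro ⟨h1, h2⟩
        exact ⟨fun h => h2 (h ▸ rfl), h1⟩
      · rintro ⟨h1, h2⟩
        exact ⟨h2, fun h => h1 (hg h2 ha h)⟩
    · rw [Finset.filter_true_of_mem]
      exact fun i hi h => hj (h ▸ Finset.mem_image_of_mem g hi)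
  · intro a ha b hb hab
    simp only [Finset.coe_filter, Set.mem_ofPred_eq] at ha hb
    exact hg ha.1 hb.1 (by rw [← hg' a ha.2, ← hg' b hb.2, hab])

theorem eq_of_abs_sum_eq {α : Type*} {s : Finset α} {a p : α → ℚ}
    (ha : IsSignVec a) (hp : ∀ j ∈ s, 0 < p j) (h : |∑ j ∈ s, a j * p j| = ∑ j ∈ s, p j) :
    ∃ e : ℚ, (e = 1 ∨ e = -1) ∧ ∀ j ∈ s, a j = e := by
  obtain ⟨e, he, h'⟩ : ∃ e : ℚ, (e = 1 ∨ e = -1) ∧ ∑ j ∈ s, e * a j * p j = ∑ j ∈ s, p j := by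
    rcases abs_choice (∑ j ∈ s, a j * p j) with h1 | h1
    · exact ⟨1, Or.inl rfl, by simpa [h1] using h⟩
    · exact ⟨-1, Or.inr rfl, by simpa [h1] using h⟩
  refine ⟨e, he, ?_⟩
  have hle : ∀ j ∈ s, e * a j * p j ≤ p j := by
    intro j hj
    have := hp j hj
    rcases he with rfl | rfl <;> rcases ha j with h1 | h1 <;> rw [h1] <;> linarith
  intro j hj
  have h1 := (Finset.sum_eq_sum_iff_of_le hle).1 h' j hj
  have h2 := hp j hj
  rcases he with rfl | rfl <;> rcases ha j with h3 | h3 <;> rw [h3] at h1 ⊢ <;> linarith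

/-- After rescaling, all rows but the first form a genuine `starMat`. -/
theorem IsStar.normalize {A : Matrix (Fin (m + 1)) (Fin n) ℚ}
    (h : IsStar r (A.submatrix Fin.succ id)) :
    ∃ (T : Finset (Fin m)) (g : Fin m → Fin n) (ε : Fin (m + 1) → ℚ) (δ : Fin n → ℚ),
      T.card = r ∧ Set.InjOn g T ∧ IsSignVec ε ∧ IsSignVec δ ∧
        ∀ i j, ε i.succ * δ j * A i.succ j = starMat T g i j := by
  obtain ⟨T, g, ε, δ, hT, hg, hε, hδ, hA⟩ := h
  refine ⟨T, g, Fin.cons 1 ε, δ, hT, hg, fun i => ?_, hδ, fun i j => ?_⟩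
  · refine Fin.cases (Or.inl rfl) (fun i => ?_) i
    simpa using hε i
  · have := hA i j
    simp only [submatrix_apply, id] at this
    rw [this, Fin.cons_succ]
    linear_combination δ j * δ j * starMat T g i j * hε.sq i + starMat T g i j * hδ.sq j

end Structure

/-! ### Reduction to smaller matrices -/

section Steps

open Module Submodule

variable {m n r : ℕ}

/-- The permanent bound for sign matrices of rank at least `r + 1`. -/
def PerBound (n r : ℕ) : Prop :=
  ∀ N : Matrix (Fin n) (Fin n) ℚ, IsSign N → r + 1 ≤ N.rank → |per N| ≤ kval n r

/-- Extremal sign matrices of rank `r + 1` are stars. -/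
def ExtremalStar (n r : ℕ) : Prop :=
  ∀ N : Matrix (Fin n) (Fin n) ℚ, IsSign N → N.rank = r + 1 → |per N| = kval n r → IsStar r N

/-- Extremal sign matrices of rank `r + 1` with two parallel columns are stars. -/
def ParExtremalStar (n r : ℕ) : Prop :=
  ∀ N : Matrix (Fin n) (Fin n) ℚ, IsSign N → N.rank = r + 1 → |per N| = kval n r →
    (∃ j k, j ≠ k ∧ Par (Nᵀ j) (Nᵀ k)) → IsStar r N

theorem ExtremalStar.par (h : ExtremalStar n r) : ParExtremalStar n r :=
  fun N hN hr hp _ => h N hN hr hp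

theorem abs_per_le_sum_minors {A : Matrix (Fin (m + 1)) (Fin (m + 1)) ℚ} (hA : IsSign A) :
    |per A| ≤ ∑ j : Fin (m + 1), |per (A.submatrix Fin.succ j.succAbove)| := by
  rw [per_succ_row]
  refine (Finset.abs_sum_le_sum_abs _ _).trans_eq (Finset.sum_congr rfl fun j _ => ?_)
  rw [abs_mul]
  rcases hA 0 j with h | h <;> simp [h]

theorem sum_ite_mem_const {α : Type*} [Fintype α] [DecidableEq α] (Z : Finset α) (x y : ℚ) :
    ∑ j, (if j ∈ Z then x else y) = Z.card * x + (Fintype.card α - Z.card : ℚ) * y := by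
  have : ∀ j, (if j ∈ Z then x else y) = y + if j ∈ Z then x - y else 0 := fun j => by
    split_ifs <;> ring
  simp only [this, Finset.sum_add_distrib, Finset.sum_ite_mem, Finset.univ_inter,
    Finset.sum_const, nsmul_eq_mul, Finset.card_univ]
  ring

theorem isStar_of_rows_eq_starMat (hm : 0 < m) {A : Matrix (Fin (m + 1)) (Fin n) ℚ} {T : Finset (Fin m)}
    {g : Fin m → Fin n} (hg : Set.InjOn g T) (hA : ∀ i j, A i.succ j = starMat T g i j) {e : ℚ}
    (he : e = 1 ∨ e = -1) (h0 : ∀ j, A 0 j = e) : IsStar T.card A := by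
  refine ⟨T.map (Fin.succEmb m), Fin.cons (g ⟨0, hm⟩) g, Fin.cons e fun _ => 1, fun _ => 1,
    by simp, ?_, fun i => ?_, fun _ => Or.inl rfl, fun i j => ?_⟩
  · intro a ha b hb hab
    simp only [Finset.coe_map, Set.mem_image, Finset.mem_coe, Fin.coe_succEmb] at ha hb
    obtain ⟨a, ha, rfl⟩ := ha
    obtain ⟨b, hb, rfl⟩ := hb
    rw [Fin.cons_succ, Fin.cons_succ] at hab
    rw [hg ha hb hab]
  · refine Fin.cases (by simpa using he) (fun i => by simp) i
  · refine Fin.cases ?_ (fun i => ?_) i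
    · simp [h0, starMat]
    · simp [hA, starMat]

theorem isStar_of_rows_eq_starMat_of_row {A : Matrix (Fin (m + 1)) (Fin n) ℚ} {T : Finset (Fin m)}
    {g : Fin m → Fin n} (hg : Set.InjOn g T) (hA : ∀ i j, A i.succ j = starMat T g i j) {e : ℚ}
    (he : e = 1 ∨ e = -1) {k : Fin n} (hk : k ∉ T.image g)
    (h0 : ∀ j, A 0 j = e * if j = k then -1 else 1) : IsStar (T.card + 1) A := by
  have h00 : (0 : Fin (m + 1)) ∉ T.map (Fin.succEmb m) := by simp
  refine ⟨insert 0 (T.map (Fin.succEmb m)), Fin.cons k g, Fin.cons e fun _ => 1, fun _ => 1,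
    by rw [Finset.card_insert_of_notMem h00, Finset.card_map], ?_, fun i => ?_,
    fun _ => Or.inl rfl, fun i j => ?_⟩
  · rw [Finset.coe_insert, Set.injOn_insert (by simp)]
    constructor
    · intro a ha b hb hab
      simp only [Finset.coe_map, Set.mem_image, Finset.mem_coe, Fin.coe_succEmb] at ha hb
      obtain ⟨a, ha, rfl⟩ := ha
      obtain ⟨b, hb, rfl⟩ := hb
      rw [Fin.cons_succ, Fin.cons_succ] at hab
      rw [hg ha hb hab]
    · rintro ⟨a, ha, hak⟩
      simp only [Finset.coe_map, Set.mem_image, Finset.mem_coe, Fin.coe_succEmb] at ha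
      obtain ⟨a, ha, rfl⟩ := ha
      rw [Fin.cons_succ, Fin.cons_zero] at hak
      exact hk (hak ▸ Finset.mem_image_of_mem g ha)
  · refine Fin.cases (by simpa using he) (fun i => by simp) i
  · refine Fin.cases ?_ (fun i => ?_) i
    · simp [h0, starMat, eq_comm]
    · simp [hA, starMat]

theorem exists_perm_cons (i : Fin (m + 1)) :
    ∃ ρ : Equiv.Perm (Fin (m + 1)), ρ 0 = i ∧ ∀ a : Fin m, ρ a.succ = i.succAbove a :=
  ⟨i.cycleRange.symm, Fin.cycleRange_symm_zero i, Fin.cycleRange_symm_succ i⟩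

theorem IsStar.of_last_rows {A : Matrix (Fin (m + 1)) (Fin (m + 1)) ℚ} (hm : 3 ≤ m)
    (hr : 1 ≤ r) (hrm : r + 1 ≤ m) (hA : IsSign A) (h : IsStar r (A.submatrix Fin.succ id))
    (hper : |per A| = kval (m + 1) r) : IsStar r A := by
  obtain ⟨k, rfl⟩ : ∃ k, m = k + 1 := ⟨m - 1, by omega⟩
  obtain ⟨T, g, ε, δ, hT, hg, hε, hδ, hs⟩ := h.normalize
  refine IsStar.of_scale hε hδ ?_
  rw [← abs_per_scale hε hδ] at hper
  have hA' := hA.scale hε hδ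
  set B : Matrix (Fin (k + 2)) (Fin (k + 2)) ℚ := fun i j => ε i * δ j * A i j with hB
  have hsub : ∀ j : Fin (k + 2), B.submatrix Fin.succ j.succAbove =
      (starMat T g).submatrix id j.succAbove := fun j => by
    ext a b
    exact hs a _
  rw [per_succ_row] at hper
  simp only [hsub, per_starMat_deleteCol T g hg, hT] at hper
  have hsum : ∑ j, kval (k + 1) (if j ∈ T.image g then r - 1 else r) = kval (k + 2) r := by
    have : ∀ j, kval (k + 1) (if j ∈ T.image g then r - 1 else r) =
      if j ∈ T.image g then kval (k + 1) (r - 1) else kval (k + 1) r := fun j => by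
        split_ifs <;> rfl
    simp only [this]
    rw [sum_ite_mem_const, kval_expand (k + 1) r (by omega), Finset.card_image_of_injOn hg, hT]
    simp
    ring
  rw [← hsum] at hper
  obtain ⟨e, he, h'⟩ := eq_of_abs_sum_eq (hA' 0) (fun j _ => by
    split_ifs <;> exact kval_pos _ _ hm (by omega)) hper
  rw [← hT]
  exact isStar_of_rows_eq_starMat (by omega) hg hs he fun j => h' j (Finset.mem_univ j)

theorem exists_perm_rank_eq {A : Matrix (Fin (m + 1)) (Fin n) ℚ} (h : A.rank ≤ m) :
    ∃ ρ : Equiv.Perm (Fin (m + 1)),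
      ((A.submatrix ρ (Equiv.refl _)).submatrix Fin.succ id).rank = A.rank := by
  have h' : Aᵀ.rank < m + 1 := by
    rw [rank_transpose]
    omega
  obtain ⟨i, hi⟩ := exists_not_coloop_of_rank_lt h'
  have := rank_deleteCol_of_not_coloop hi
  rw [rank_transpose, ← transpose_submatrix, rank_transpose] at this
  obtain ⟨ρ, -, hρ⟩ := exists_perm_cons i
  refine ⟨ρ, ?_⟩
  rw [← this]
  congr 1
  ext a b
  simp [hρ]

theorem exact_of_rank_le_aux {A : Matrix (Fin (m + 1)) (Fin (m + 1)) ℚ} (hm : 3 ≤ m) (hr : 1 ≤ r)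
    (hrm : r + 1 ≤ m) (hB : PerBound m r) (hB' : PerBound m (r - 1)) (hE : ParExtremalStar m (r - 1))
    (hE1 : r = 1 → ParExtremalStar m 1) (hlt : kval m r < kval m (r - 1)) (hA : IsSign A)
    (hrk : (A.submatrix Fin.succ id).rank = r + 1) :
    |per A| ≤ kval (m + 1) r ∧ (|per A| = kval (m + 1) r → IsStar r A) := by
  classical
  set R := A.submatrix Fin.succ id with hRdef
  have hR : IsSign R := hA.submatrix _ _
  set Z : Finset (Fin (m + 1)) := Finset.univ.filter fun j => Coloop R j
  have hZ : ∀ j, j ∈ Z ↔ Coloop R j := fun j => by simp [Z]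
  have hrank := rank_eq_card_add R Z fun j hj => (hZ j).1 hj
  rw [hrk] at hrank
  obtain ⟨c, hc⟩ : ∃ c, c ∉ Z := by
    by_contra! h
    rw [(Finset.eq_univ_iff_forall.2 h), Finset.card_fin] at hrank
    omega
  have hpos := hR.finrank_pos (by omega) (S := (Z : Set (Fin (m + 1)))ᶜ) (j := c) (by simpa)
  have hZr : Z.card ≤ r := by omega
  have hsub : ∀ j : Fin (m + 1), A.submatrix Fin.succ j.succAbove = R.submatrix id j.succAbove :=
    fun j => rfl
  have hmem : ∀ j ∈ Z, (R.submatrix id j.succAbove).rank = r - 1 + 1 := fun j hj => by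
    have := ((hZ j).1 hj).rank_deleteCol
    omega
  have hnot : ∀ j ∉ Z, (R.submatrix id j.succAbove).rank = r + 1 := fun j hj => by
    rw [rank_deleteCol_of_not_coloop (fun h => hj ((hZ j).2 h)), hrk]
  have hle : ∀ j ∈ Finset.univ, |per (A.submatrix Fin.succ j.succAbove)| ≤
      if j ∈ Z then kval m (r - 1) else kval m r := by
    intro j _
    rw [hsub]
    split_ifs with hj
    · exact hB' _ (hR.submatrix _ _) (hmem j hj).ge
    · exact hB _ (hR.submatrix _ _) (hnot j hj).ge
  have hsum := (abs_per_le_sum_minors hA).trans (Finset.sum_le_sum hle)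
  have h1 := sum_ite_mem_const Z (kval m (r - 1)) (kval m r)
  have h2 := kval_expand m r (by omega)
  rw [Fintype.card_fin] at h1
  push_cast at h1
  have h3 : (Z.card : ℚ) ≤ r := by exact_mod_cast hZr
  have hup : ∑ j, (if j ∈ Z then kval m (r - 1) else kval m r) ≤ kval (m + 1) r := by
    rw [h1, h2]
    nlinarith
  refine ⟨hsum.trans hup, fun heq => ?_⟩
  have hcard : Z.card = r := by
    refine le_antisymm hZr ?_
    by_contra! hlt'
    have h4 : (Z.card : ℚ) < r := by exact_mod_cast hlt'
    have : ∑ j, (if j ∈ Z then kval m (r - 1) else kval m r) < kval (m + 1) r := by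
      rw [h1, h2]
      nlinarith
    linarith
  have heach := (Finset.sum_eq_sum_iff_of_le hle).1
    (le_antisymm (Finset.sum_le_sum hle) (hup.trans (heq ▸ abs_per_le_sum_minors hA)))
  have hpar : ∀ c ∉ Z, ∀ d ∉ Z, Par (Rᵀ c) (Rᵀ d) := fun c hc d hd =>
    hR.par_of_finrank_le_one (by omega) (S := (Z : Set (Fin (m + 1)))ᶜ) (by omega) (by simpa)
      (by simpa)
  refine IsStar.of_last_rows hm hr hrm hA ?_ heq
  rw [← hRdef, ← hcard]
  refine isStar_of_deleteCol hR hm (fun j hj => (hZ j).1 hj) (by omega) hpar fun j hj => ?_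
  rcases Nat.lt_or_ge 1 r with h1r | h1r
  · obtain ⟨k, hk, hkj⟩ : ∃ k ∈ Z, k ≠ j := Finset.exists_mem_ne (by omega) j
    refine ⟨k, hkj, ?_, fun h => ?_⟩
    · rw [Finset.insert_eq_of_mem hk]
      omega
    · rw [Finset.card_erase_of_mem hk, hcard]
      have := heach k (Finset.mem_univ k)
      rw [if_pos hk] at this
      exact hE _ (hR.submatrix _ _) (hmem k hk) this h
  · obtain rfl : r = 1 := by omega
    refine ⟨c, fun h => hc (h ▸ hj), ?_, fun h => ?_⟩
    · rw [Finset.card_insert_of_notMem hc]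
      omega
    · rw [Finset.erase_eq_of_notMem hc, hcard]
      have := heach c (Finset.mem_univ c)
      rw [if_neg hc] at this
      exact hE1 rfl _ (hR.submatrix _ _) (hnot c hc) this h

/-- Singular matrices of order `m + 1`, from the facts at order `m`. -/
theorem exact_of_rank_le {A : Matrix (Fin (m + 1)) (Fin (m + 1)) ℚ} (hm : 3 ≤ m) (hr : 1 ≤ r)
    (hrm : r + 1 ≤ m) (hB : PerBound m r) (hB' : PerBound m (r - 1)) (hE : ParExtremalStar m (r - 1))
    (hE1 : r = 1 → ParExtremalStar m 1) (hlt : kval m r < kval m (r - 1)) (hA : IsSign A)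
    (hrk : A.rank = r + 1) :
    |per A| ≤ kval (m + 1) r ∧ (|per A| = kval (m + 1) r → IsStar r A) := by
  obtain ⟨ρ, hρ⟩ := exists_perm_rank_eq (A := A) (by omega)
  have := exact_of_rank_le_aux hm hr hrm hB hB' hE hE1 hlt (hA.submatrix ρ (Equiv.refl _))
    (hρ.trans hrk)
  rw [per_submatrix] at this
  exact ⟨this.1, fun h => (this.2 h).of_submatrix⟩

end Steps

/-! ### Nonsingular matrices with nearly parallel columns -/

section Full

open Module Submodule

variable {m n r : ℕ}

/-- Two columns of `A` agree up to a sign outside a single row. -/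
def HasCloseCols (A : Matrix (Fin m) (Fin n) ℚ) : Prop :=
  ∃ i j k, j ≠ k ∧ ∃ s : ℚ, (s = 1 ∨ s = -1) ∧ ∀ l, l ≠ i → A l j = s * A l k

theorem not_par_of_rank_eq {A : Matrix (Fin (m + 1)) (Fin (m + 1)) ℚ} (h : A.rank = m + 1)
    {j k : Fin (m + 1)} (hjk : j ≠ k) : ¬ Par (Aᵀ j) (Aᵀ k) := fun hp => by
  have h1 := rank_deleteCol_of_not_coloop (not_coloop_of_par hjk hp)
  have h2 := rank_le_width (A.submatrix id j.succAbove)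
  omega

theorem rank_le_of_par_cols {A : Matrix (Fin m) (Fin (n + 1)) ℚ} {j k : Fin (n + 1)} (hjk : j ≠ k)
    (hp : Par (Aᵀ j) (Aᵀ k)) : A.rank ≤ n := by
  rw [← rank_deleteCol_of_not_coloop (not_coloop_of_par hjk hp)]
  exact rank_le_width _

theorem per_of_close {A : Matrix (Fin (m + 1)) (Fin (m + 1)) ℚ} {j k : Fin (m + 1)} (hjk : j ≠ k)
    {s : ℚ} (hs : s = 1 ∨ s = -1) (h : ∀ i : Fin m, A i.succ j = s * A i.succ k)
    (h0 : A 0 j = -(s * A 0 k)) :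
    per A = ∑ l ∈ Finset.univ \ {j, k}, A 0 l * per (A.submatrix Fin.succ l.succAbove) := by
  have hss : s * s = 1 := by rcases hs with rfl | rfl <;> norm_num
  set δ : Fin (m + 1) → ℚ := fun l => if l = j ∨ l = k then s else 1 with hδ
  set B : Matrix (Fin (m + 1)) (Fin (m + 1)) ℚ :=
    fun i l => (1 : Fin (m + 1) → ℚ) i * δ l * A.submatrix (Equiv.refl _) (Equiv.swap j k) i l
    with hB
  have hBv : ∀ i l, B i l = if l = j then s * A i k else if l = k then s * A i j else A i l := by
    intro i l
    simp only [hB, hδ, Pi.one_apply, one_mul, submatrix_apply, Equiv.refl_apply]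
    by_cases h1 : l = j
    · simp [h1]
    · by_cases h2 : l = k
      · simp [h2, hjk.symm]
      · simp [h1, h2, Equiv.swap_apply_of_ne_of_ne h1 h2]
  have hprod : ∏ l, δ l = 1 := by
    have : ∀ l, δ l = (if l = j then s else 1) * if l = k then s else 1 := by
      intro l
      by_cases h1 : l = j
      · simp [hδ, h1, hjk]
      · simp [hδ, h1]
    simp only [this, Finset.prod_mul_distrib, Finset.prod_ite_eq', Finset.mem_univ, if_true, hss]
  have hperB : per B = per A := by
    rw [hB, per_scale, per_submatrix, hprod]
    simp
  have hsub : ∀ l : Fin (m + 1),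
      B.submatrix Fin.succ l.succAbove = A.submatrix Fin.succ l.succAbove := by
    intro l
    ext a b
    simp only [submatrix_apply, hBv]
    split_ifs with h1 h2
    · rw [h1, h]
    · rw [h2, h, ← mul_assoc, hss, one_mul]
    · rfl
  have e1 := per_succ_row A
  have e2 := per_succ_row B
  simp only [hsub] at e2
  rw [hperB] at e2
  have e3 : per A = ∑ l, (A 0 l + B 0 l) / 2 * per (A.submatrix Fin.succ l.succAbove) := by
    have : per A = (per A + per A) / 2 := by ring
    rw [this]
    nth_rw 1 [e1]
    rw [e2, ← Finset.sum_add_distrib, Finset.sum_div]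
    exact Finset.sum_congr rfl fun l _ => by ring
  rw [e3, ← Finset.sum_sdiff (Finset.subset_univ {j, k}), Finset.sum_pair hjk, hBv, hBv]
  simp only [if_true, if_neg hjk.symm]
  rw [h0]
  have : ∀ l ∈ Finset.univ \ {j, k}, (A 0 l + B 0 l) / 2 *
      per (A.submatrix Fin.succ l.succAbove) =
      A 0 l * per (A.submatrix Fin.succ l.succAbove) := by
    intro l hl
    simp only [Finset.mem_sdiff, Finset.mem_univ, true_and, Finset.mem_insert,
      Finset.mem_singleton, not_or] at hl
    rw [hBv, if_neg hl.1, if_neg hl.2]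
    ring
  rw [Finset.sum_congr rfl this]
  linear_combination (-A 0 k / 2 * per (A.submatrix Fin.succ k.succAbove)) * hss

theorem card_univ_sdiff_pair {j k : Fin (m + 1)} (hjk : j ≠ k) :
    (Finset.univ \ {j, k}).card = m - 1 := by
  rw [Finset.card_sdiff_of_subset (Finset.subset_univ _), Finset.card_pair hjk, Finset.card_fin]
  omega

theorem IsStar.of_last_rows_full {A : Matrix (Fin (m + 3)) (Fin (m + 3)) ℚ} (hm : 1 ≤ m)
    (hA : IsSign A) (hrk : A.rank = m + 3) (h : IsStar (m + 1) (A.submatrix Fin.succ id))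
    (hper : |per A| = kval (m + 3) (m + 2)) : IsStar (m + 2) A := by
  obtain ⟨T, g, ε, δ, hT, hg, hε, hδ, hs⟩ := h.normalize
  refine IsStar.of_scale hε hδ ?_
  rw [← abs_per_scale hε hδ] at hper
  have hA' := hA.scale hε hδ
  have hnp : ∀ j k, j ≠ k → ¬ ∀ i, ε i * δ j * A i j = ε i * δ k * A i k := by
    intro j k hjk h
    refine not_par_of_rank_eq hrk hjk ⟨δ j * δ k, hδ.mul (fun _ => hδ k) j, fun i => ?_⟩
    have := h i
    simp only [transpose_apply]
    linear_combination ε i * δ j * this - (A i j - δ j * δ k * A i k) * hε.sq i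
      - ε i * ε i * A i j * hδ.sq j
  set B : Matrix (Fin (m + 3)) (Fin (m + 3)) ℚ := fun i j => ε i * δ j * A i j with hB
  have hsub : ∀ j : Fin (m + 3), B.submatrix Fin.succ j.succAbove =
      (starMat T g).submatrix id j.succAbove := fun j => by
    ext a b
    exact hs a _
  have hTg : (T.image g).card = m + 1 := by rw [Finset.card_image_of_injOn hg, hT]
  obtain ⟨j, k, hj, hk, hjk⟩ := exists_two_notMem (T.image g) (by simp [hTg])
  have hone : ∀ l ∉ T.image g, ∀ i : Fin (m + 2), B i.succ l = 1 := by
    intro l hl i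
    rw [hB]
    simp only [hs, starMat]
    rw [if_neg]
    rintro ⟨h1, rfl⟩
    exact hl (Finset.mem_image_of_mem g h1)
  have h0 : B 0 j = -B 0 k := by
    rcases eq_or_eq_neg_of_sign (hA' 0 j) (hA' 0 k) with h | h
    · refine absurd (fun i => ?_) (hnp j k hjk)
      refine Fin.cases h (fun i => ?_) i
      exact (hone j hj i).trans (hone k hk i).symm
    · exact h
  have hform := per_of_close (A := B) hjk (Or.inl rfl)
    (fun i => by rw [hone j hj i, hone k hk i, one_mul]) (by rw [one_mul]; exact h0)
  have himg : T.image g = Finset.univ \ {j, k} := by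
    refine Finset.eq_of_subset_of_card_le (fun x hx => ?_) ?_
    · simp only [Finset.mem_sdiff, Finset.mem_univ, true_and, Finset.mem_insert,
        Finset.mem_singleton, not_or]
      exact ⟨fun h => hj (h ▸ hx), fun h => hk (h ▸ hx)⟩
    · rw [hTg, card_univ_sdiff_pair hjk]
      omega
  rw [← himg] at hform
  have hmin : ∀ l ∈ T.image g, B 0 l * per (B.submatrix Fin.succ l.succAbove) =
      B 0 l * kval (m + 2) m := by
    intro l hl
    rw [hsub, per_starMat_deleteCol T g hg, if_pos hl, hT, Nat.add_sub_cancel]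
  rw [Finset.sum_congr rfl hmin] at hform
  rw [hform, kval_full] at hper
  have hpos := kval_pos (m + 2) m (by omega) (by omega)
  obtain ⟨e, he, h'⟩ := eq_of_abs_sum_eq (s := T.image g) (p := fun _ => kval (m + 2) m)
    (hA' 0) (fun _ _ => hpos) (by
      rw [hper, Finset.sum_const, hTg]
      simp)
  obtain ⟨k', hk', hk'e⟩ : ∃ k', k' ∉ T.image g ∧ ∀ l, B 0 l = e * if l = k' then -1 else 1 := by
    have hcases : ∀ l, l ∈ T.image g ∨ l = j ∨ l = k := by
      intro l
      rw [himg]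
      by_cases h1 : l = j <;> by_cases h2 : l = k <;> simp [h1, h2]
    rcases eq_or_eq_neg_of_sign (hA' 0 k) he with h1 | h1
    · refine ⟨j, hj, fun l => ?_⟩
      rcases hcases l with hl | rfl | rfl
      · rw [if_neg (fun h : l = j => hj (h ▸ hl)), h' l hl, mul_one]
      · have h1' : B 0 k = e := h1
        rw [if_pos rfl, h0, h1']
        ring
      · rw [if_neg hjk.symm, mul_one]
        exact h1
    · refine ⟨k, hk, fun l => ?_⟩
      have h1' : B 0 k = -e := h1
      rcases hcases l with hl | rfl | rfl
      · rw [if_neg (fun h : l = k => hk (h ▸ hl)), h' l hl, mul_one]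
      · rw [if_neg hjk, h0, h1']
        ring
      · rw [if_pos rfl, h1']
        ring
  have := isStar_of_rows_eq_starMat_of_row hg hs he hk' hk'e
  rwa [hT] at this

theorem exact_of_hasCloseCols_aux {A : Matrix (Fin (m + 3)) (Fin (m + 3)) ℚ} (hm : 1 ≤ m)
    (hB : PerBound (m + 2) m) (hE : ParExtremalStar (m + 2) m) (hA : IsSign A)
    (hrk : A.rank = m + 3) {j k : Fin (m + 3)} (hjk : j ≠ k) {s : ℚ} (hs : s = 1 ∨ s = -1)
    (h : ∀ i : Fin (m + 2), A i.succ j = s * A i.succ k) :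
    |per A| ≤ kval (m + 3) (m + 2) ∧ (|per A| = kval (m + 3) (m + 2) → IsStar (m + 2) A) := by
  set R := A.submatrix Fin.succ id with hRdef
  have hR : IsSign R := hA.submatrix _ _
  have hRjk : Par (Rᵀ j) (Rᵀ k) := ⟨s, hs, h⟩
  have hRrank : R.rank = m + 2 := by
    have h1 := rank_le_rank_deleteRow A
    have h2 := rank_le_height R
    rw [← hRdef] at h1
    omega
  have h0 : A 0 j = -(s * A 0 k) := by
    rcases eq_or_eq_neg_of_sign (hA 0 j) (IsSignVec.mul (fun _ : Unit => hs) (fun _ => hA 0 k) ())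
      with h1 | h1
    · refine absurd ⟨s, hs, fun i => ?_⟩ (not_par_of_rank_eq hrk hjk)
      exact Fin.cases h1 h i
    · exact h1
  set Z : Finset (Fin (m + 3)) := Finset.univ \ {j, k} with hZdef
  have hZ : ∀ l, l ∈ Z ↔ l ≠ j ∧ l ≠ k := fun l => by simp [Z]
  have hZcard : Z.card = m + 1 := by rw [hZdef, card_univ_sdiff_pair hjk]; omega
  have hmin : ∀ l ∈ Z, (R.submatrix id l.succAbove).rank = m + 1 ∧ Coloop R l := by
    intro l hl
    obtain ⟨j', hj'⟩ := Fin.exists_succAbove_eq ((hZ l).1 hl).1.symm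
    obtain ⟨k', hk'⟩ := Fin.exists_succAbove_eq ((hZ l).1 hl).2.symm
    have hpar : Par ((R.submatrix id l.succAbove)ᵀ j') ((R.submatrix id l.succAbove)ᵀ k') := by
      subst hj' hk'
      exact hRjk
    have h1 : (R.submatrix id l.succAbove).rank ≤ m + 1 :=
      rank_le_of_par_cols (fun h => hjk (by rw [← hj', ← hk', h])) hpar
    have h2 := rank_le_rank_deleteCol R l
    refine ⟨by omega, ?_⟩
    by_contra hnot
    have := rank_deleteCol_of_not_coloop hnot
    omega
  have hform := per_of_close hjk hs h h0
  rw [← hZdef] at hform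
  have hsub : ∀ j : Fin (m + 3), A.submatrix Fin.succ j.succAbove = R.submatrix id j.succAbove :=
    fun j => rfl
  have hle : ∀ l ∈ Z, |A 0 l * per (A.submatrix Fin.succ l.succAbove)| ≤ kval (m + 2) m := by
    intro l hl
    rw [abs_mul, hsub]
    have := hB _ (hR.submatrix id l.succAbove) (hmin l hl).1.ge
    rcases hA 0 l with h | h <;> rw [h] <;> simpa using this
  have hsum : ∑ _l ∈ Z, kval (m + 2) m = kval (m + 3) (m + 2) := by
    rw [Finset.sum_const, hZcard, kval_full]
    simp
  have habs := Finset.abs_sum_le_sum_abs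
    (fun l => A 0 l * per (A.submatrix Fin.succ l.succAbove)) Z
  rw [← hform] at habs
  refine ⟨habs.trans ((Finset.sum_le_sum hle).trans_eq hsum), fun heq => ?_⟩
  have heach := (Finset.sum_eq_sum_iff_of_le hle).1
    (le_antisymm (Finset.sum_le_sum hle) (hsum.trans_le (heq ▸ habs)))
  refine IsStar.of_last_rows_full hm hA hrk ?_ heq
  rw [← hRdef, ← hZcard]
  refine isStar_of_deleteCol hR (by omega) (fun l hl => (hmin l hl).2) (by omega) ?_ ?_
  · intro c hc d hd
    have hcases : ∀ l, l ∉ Z → l = j ∨ l = k := by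
      intro l hl
      by_contra! h
      exact hl ((hZ l).2 h)
    rcases hcases c hc with rfl | rfl <;> rcases hcases d hd with rfl | rfl
    · exact Par.refl _
    · exact hRjk
    · exact hRjk.symm
    · exact Par.refl _
  · intro l hl
    obtain ⟨q, hq, hql⟩ : ∃ q ∈ Z, q ≠ l := Finset.exists_mem_ne (by omega) l
    refine ⟨q, hql, ?_, fun h => ?_⟩
    · rw [Finset.insert_eq_of_mem hq]
      omega
    · rw [Finset.card_erase_of_mem hq, hZcard]
      refine hE _ (hR.submatrix _ _) (hmin q hq).1 ?_ h
      have := heach q hq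
      rw [abs_mul, hsub] at this
      rcases hA 0 q with h | h <;> rw [h] at this <;> simpa using this

/-- Nonsingular matrices with two columns that nearly agree up to a sign. -/
theorem exact_of_hasCloseCols {A : Matrix (Fin (m + 3)) (Fin (m + 3)) ℚ} (hm : 1 ≤ m)
    (hB : PerBound (m + 2) m) (hE : ParExtremalStar (m + 2) m) (hA : IsSign A)
    (hrk : A.rank = m + 3) (h : HasCloseCols A) :
    |per A| ≤ kval (m + 3) (m + 2) ∧ (|per A| = kval (m + 3) (m + 2) → IsStar (m + 2) A) := by
  obtain ⟨i, j, k, hjk, s, hs, h⟩ := h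
  obtain ⟨ρ, -, hρ⟩ := exists_perm_cons i
  have := exact_of_hasCloseCols_aux hm hB hE (hA.submatrix ρ (Equiv.refl _))
    (by rw [rank_submatrix, hrk]) hjk hs
    (fun a => by simpa [hρ] using h _ (Fin.succAbove_ne i a))
  rw [per_submatrix] at this
  exact ⟨this.1, fun h => (this.2 h).of_submatrix⟩

end Full

/-! ### Matrices without nearly parallel lines -/

section Far

open Module Submodule

variable {m n r : ℕ}

/-- Two vectors agree up to a sign outside a single position. -/
def IsClose {α : Type*} (u v : α → ℚ) : Prop :=
  ∃ i, ∃ s : ℚ, (s = 1 ∨ s = -1) ∧ ∀ l, l ≠ i → u l = s * v l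

theorem exists_card_of_not_isClose {u v : Fin n → ℚ} (hn : 0 < n) (hu : IsSignVec u)
    (hv : IsSignVec v) (h : ¬ IsClose u v) :
    ∃ s t : ℕ, (Finset.univ.filter fun j => u j = v j).card = s ∧ s + t = n ∧ 2 ≤ s ∧ 2 ≤ t := by
  set S := Finset.univ.filter fun j => u j = v j
  have hS : ∀ j, j ∈ S ↔ u j = v j := fun j => by simp [S]
  have hSc : S.card + Sᶜ.card = n := by rw [Finset.card_add_card_compl, Fintype.card_fin]
  have : Nonempty (Fin n) := ⟨⟨0, hn⟩⟩
  have key : ∀ T : Finset (Fin n), T.card ≤ 1 → ∃ i, ∀ l, l ≠ i → l ∉ T := by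
    intro T hT
    rcases Finset.card_le_one_iff_subset_singleton (s := T) |>.1 hT with ⟨i, hi⟩
    exact ⟨i, fun l hl hlT => hl (Finset.mem_singleton.1 (hi hlT))⟩
  refine ⟨_, _, rfl, hSc, ?_, ?_⟩
  · by_contra! hlt
    obtain ⟨i, hi⟩ := key S (by omega)
    refine h ⟨i, -1, Or.inr rfl, fun l hl => ?_⟩
    rcases eq_or_eq_neg_of_sign (hu l) (hv l) with h1 | h1
    · exact absurd ((hS l).2 h1) (hi l hl)
    · rw [h1, neg_one_mul]
  · by_contra! hlt
    obtain ⟨i, hi⟩ := key Sᶜ (by omega)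
    refine h ⟨i, 1, Or.inl rfl, fun l hl => ?_⟩
    have := hi l hl
    rw [Finset.mem_compl, not_not, hS] at this
    rw [this, one_mul]

theorem rank_deleteTwoCols (R : Matrix (Fin m) (Fin (n + 2)) ℚ) (j : Fin (n + 2))
    (k : Fin (n + 1)) :
    (R.submatrix id fun i => j.succAbove (k.succAbove i)).rank =
      finrank ℚ (span ℚ (R.col '' {j, j.succAbove k}ᶜ)) := by
  rw [rank_eq_finrank_span_cols]
  have : Set.range (R.submatrix id fun i => j.succAbove (k.succAbove i)).col =
      R.col '' {j, j.succAbove k}ᶜ := by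
    have h : ({j, j.succAbove k}ᶜ : Set (Fin (n + 2))) =
        Set.range fun i => j.succAbove (k.succAbove i) := by
      ext x
      simp only [Set.mem_compl_iff, Set.mem_insert_iff, Set.mem_singleton_iff, not_or,
        Set.mem_range]
      constructor
      · rintro ⟨h1, h2⟩
        obtain ⟨y, rfl⟩ := Fin.exists_succAbove_eq h1
        obtain ⟨z, rfl⟩ := Fin.exists_succAbove_eq (fun h : y = k => h2 (h ▸ rfl))
        exact ⟨z, rfl⟩
      · rintro ⟨y, rfl⟩
        exact ⟨Fin.succAbove_ne _ _,
          fun h => Fin.succAbove_ne _ _ (Fin.succAbove_right_injective h)⟩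
    rw [h, ← Set.range_comp]
    rfl
  rw [this]

theorem rank_le_finrank_pair {R : Matrix (Fin m) (Fin (n + 1)) ℚ} {j k : Fin (n + 1)}
    (hjk : j ≠ k) (hj : ¬ Coloop R j) :
    R.rank ≤ finrank ℚ (span ℚ (R.col '' {j, k}ᶜ)) + 1 := by
  rw [← rank_deleteCol_of_not_coloop hj, rank_deleteCol]
  have : ({j}ᶜ : Set (Fin (n + 1))) = insert k {j, k}ᶜ := by
    ext x
    by_cases h1 : x = k
    · simp [h1, hjk.symm]
    · simp [h1]
  rw [this, Set.image_insert_eq]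
  exact finrank_span_insert_le _ _

open Classical in
theorem rank_le_deleteTwoCols (R : Matrix (Fin m) (Fin (n + 2)) ℚ) (j : Fin (n + 2))
    (k : Fin (n + 1)) :
    R.rank ≤ (R.submatrix id fun i => j.succAbove (k.succAbove i)).rank +
      if Coloop R j ∧ Coloop R (j.succAbove k) then 2 else 1 := by
  split_ifs with h
  · have h1 := rank_le_rank_deleteCol R j
    have h2 := rank_le_rank_deleteCol (R.submatrix id j.succAbove) k
    have : (R.submatrix id j.succAbove).submatrix id k.succAbove =
      R.submatrix id fun i => j.succAbove (k.succAbove i) := rfl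
    rw [this] at h2
    omega
  · rw [rank_deleteTwoCols]
    rw [not_and_or] at h
    rcases h with h | h
    · exact rank_le_finrank_pair (Fin.succAbove_ne j k).symm h
    · rw [Set.pair_comm]
      exact rank_le_finrank_pair (Fin.succAbove_ne j k) h

theorem abs_per_le_of_coloops {A : Matrix (Fin (m + 5)) (Fin (m + 5)) ℚ} (hA : IsSign A)
    (hU : PerBound (m + 3) (m + 1)) (hV : PerBound (m + 3) m)
    (hnc : ¬ IsClose (A 0) (A 1))
    (hrk : (A.submatrix (fun i : Fin (m + 3) => i.succ.succ) id).rank = m + 3) {z : ℕ}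
    (hz : ∀ Z : Finset (Fin (m + 5)),
      (∀ j ∈ Z, Coloop (A.submatrix (fun i : Fin (m + 3) => i.succ.succ) id) j) → Z.card ≤ z)
    (hz1 : 1 ≤ z) :
    |per A| ≤ ((m + 3 : ℚ) * (m + 2) + 2) * kval (m + 3) (m + 1) +
      (z : ℚ) * (z - 1) * (kval (m + 3) m - kval (m + 3) (m + 1)) := by
  classical
  obtain ⟨s, t, hs, hst, h2s, h2t⟩ :=
    exists_card_of_not_isClose (by omega) (hA 0) (hA 1) hnc
  set R := A.submatrix (fun i : Fin (m + 3) => i.succ.succ) id with hRdef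
  have hR : IsSign R := hA.submatrix _ _
  set Z : Finset (Fin (m + 5)) := Finset.univ.filter fun j => Coloop R j
  have hZ : ∀ j, j ∈ Z ↔ Coloop R j := fun j => by simp [Z]
  have hZz := hz Z fun j hj => (hZ j).1 hj
  have hVU : kval (m + 3) (m + 1) ≤ kval (m + 3) m :=
    kval_anti _ _ _ (by omega) (by omega) (by omega)
  have hUpos := kval_pos (m + 3) (m + 1) (by omega) (by omega)
  have hbound : ∀ (j : Fin (m + 5)) (k : Fin (m + 4)),
      |per (A.submatrix (fun i : Fin (m + 3) => i.succ.succ)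
        fun i => j.succAbove (k.succAbove i))| ≤ kval (m + 3) (m + 1) +
        if j ∈ Z ∧ j.succAbove k ∈ Z then kval (m + 3) m - kval (m + 3) (m + 1) else 0 := by
    intro j k
    have h1 := rank_le_deleteTwoCols R j k
    have h2 : A.submatrix (fun i : Fin (m + 3) => i.succ.succ)
      (fun i => j.succAbove (k.succAbove i)) =
      R.submatrix id fun i => j.succAbove (k.succAbove i) := rfl
    rw [h2]
    simp only [hZ]
    split_ifs at h1 ⊢ with h
    · rw [add_sub_cancel]
      exact hV _ (hR.submatrix _ _) (by omega)
    · rw [add_zero]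
      exact hU _ (hR.submatrix _ _) (by omega)
  refine (abs_per_le_of_pair hA Z (sub_nonneg.2 hVU) hbound s t hs hst).trans ?_
  refine add_le_add (mul_le_mul_of_nonneg_right ?_ hUpos.le)
    (mul_le_mul_of_nonneg_right ?_ (sub_nonneg.2 hVU))
  · have e1 : (s : ℚ) + t = m + 5 := by exact_mod_cast hst
    have e2 : (2 : ℚ) ≤ s := by exact_mod_cast h2s
    have e3 : (2 : ℚ) ≤ t := by exact_mod_cast h2t
    nlinarith
  · rcases Nat.eq_zero_or_pos Z.card with h | h
    · rw [h]
      have : (1 : ℚ) ≤ z := by exact_mod_cast hz1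
      push_cast
      nlinarith
    · have e1 : (1 : ℚ) ≤ Z.card := by exact_mod_cast h
      have e2 : (Z.card : ℚ) ≤ z := by exact_mod_cast hZz
      nlinarith

theorem far_lt (m : ℕ) :
    ((m + 3 : ℚ) * (m + 2) + 2) * kval (m + 3) (m + 1) +
      ((m + 1 : ℕ) : ℚ) * ((m + 1 : ℕ) - 1) * (kval (m + 3) m - kval (m + 3) (m + 1)) <
      kval (m + 5) (m + 4) := by
  have e1 : kval (m + 5) (m + 4) = _ := kval_full (m + 2)
  have e2 : kval (m + 4) (m + 2) = _ := kval_expand (m + 3) (m + 2) (by omega)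
  have e3 := kval_full m
  have e4 : kval (m + 3) (m + 2) = kval (m + 3) (m + 1) - 2 * kval (m + 2) (m + 1) :=
    kval_succ (m + 2) (m + 1)
  have e5 : kval (m + 3) (m + 1) = kval (m + 3) m - 2 * kval (m + 2) m := kval_succ (m + 2) m
  have hlt : kval (m + 2) (m + 1) < (m + 1) * kval (m + 2) m := by
    rcases Nat.eq_zero_or_pos m with rfl | hm
    · norm_num [kval, Nat.factorial]
    · have h1 := kval_anti (m + 2) m (m + 1) (by omega) (by omega) (by omega)
      have h2 := kval_pos (m + 2) m (by omega) (by omega)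
      have h3 : (1 : ℚ) ≤ m := by exact_mod_cast hm
      nlinarith
  simp only [show m + 2 - 1 = m + 1 by omega] at e2
  push_cast at e1 e2 ⊢
  have hU : kval (m + 3) (m + 1) = (m + 1) * kval (m + 2) m + 2 * kval (m + 2) (m + 1) := by
    linarith
  have hV : kval (m + 3) m = kval (m + 3) (m + 1) + 2 * kval (m + 2) m := by linarith
  rw [e1]
  simp only [show m + 2 + 2 = m + 4 by omega]
  rw [e2, e3, hV, hU]
  linarith

theorem exists_eq_of_three {x y z : ℚ} (hx : x = 1 ∨ x = -1) (hy : y = 1 ∨ y = -1)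
    (hz : z = 1 ∨ z = -1) : x = y ∨ x = z ∨ y = z := by
  rcases hx with rfl | rfl <;> rcases hy with rfl | rfl <;> rcases hz with rfl | rfl <;> simp

theorem hasCloseCols_of_par {A : Matrix (Fin (m + 2)) (Fin n) ℚ} (hA : IsSign A) {a b c : Fin n}
    (hab : a ≠ b) (hac : a ≠ c) (hbc : b ≠ c)
    (h1 : Par ((A.submatrix (fun i : Fin m => i.succ.succ) id)ᵀ b)
      ((A.submatrix (fun i : Fin m => i.succ.succ) id)ᵀ a))
    (h2 : Par ((A.submatrix (fun i : Fin m => i.succ.succ) id)ᵀ c)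
      ((A.submatrix (fun i : Fin m => i.succ.succ) id)ᵀ a)) : HasCloseCols A := by
  obtain ⟨s, hs, hsb⟩ := h1
  obtain ⟨t, ht, htc⟩ := h2
  simp only [transpose_apply, submatrix_apply, id] at hsb htc
  have hss : s * s = 1 := by rcases hs with rfl | rfl <;> norm_num
  have htt : t * t = 1 := by rcases ht with rfl | rfl <;> norm_num
  have hst : s * t = 1 ∨ s * t = -1 := by
    rcases hs with rfl | rfl <;> rcases ht with rfl | rfl <;> simp
  have hext : ∀ (j k : Fin n) (u : ℚ), (∀ i : Fin m, A i.succ.succ j = u * A i.succ.succ k) →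
      A 1 j = u * A 1 k → ∀ l, l ≠ 0 → A l j = u * A l k := by
    intro j k u h h' l
    refine Fin.cases (fun h => absurd rfl h) (fun l _ => ?_) l
    refine Fin.cases h' (fun l => h l) l
  rcases exists_eq_of_three (hA 1 a) (IsSignVec.mul (fun _ : Unit => hs) (fun _ => hA 1 b) ())
    (IsSignVec.mul (fun _ : Unit => ht) (fun _ => hA 1 c) ()) with h | h | h
  · exact ⟨0, b, a, hab.symm, s, hs, hext _ _ _ hsb (by rw [h, ← mul_assoc, hss, one_mul])⟩
  · exact ⟨0, c, a, hac.symm, t, ht, hext _ _ _ htc (by rw [h, ← mul_assoc, htt, one_mul])⟩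
  · refine ⟨0, b, c, hbc, s * t, hst, hext _ _ _ (fun i => ?_) ?_⟩
    · rw [hsb, htc]
      linear_combination (-s * A i.succ.succ a) * htt
    · linear_combination s * h - A 1 b * hss

theorem card_coloops_lt {R : Matrix (Fin m) (Fin n) ℚ} (hR : IsSign R) (hm : 0 < m) (hmn : m < n)
    {Z : Finset (Fin n)} (hZ : ∀ j ∈ Z, Coloop R j) : Z.card < m := by
  have hrank := rank_eq_card_add R Z hZ
  have := rank_le_height R
  obtain ⟨c, hc⟩ : ∃ c, c ∉ Z := by
    by_contra! h
    rw [(Finset.eq_univ_iff_forall.2 h), Finset.card_fin] at hrank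
    omega
  have hpos := hR.finrank_pos hm (S := (Z : Set (Fin n))ᶜ) (j := c) (by simpa)
  omega

/-- Nonsingular matrices without such columns and with two rows that are not close. -/
theorem abs_per_lt_of_not_close {A : Matrix (Fin (m + 5)) (Fin (m + 5)) ℚ} (hA : IsSign A)
    (hU : PerBound (m + 3) (m + 1)) (hV : PerBound (m + 3) m) (hrk : A.rank = m + 5)
    (hrow : ¬ IsClose (A 0) (A 1)) (hcol : ¬ HasCloseCols A) :
    |per A| < kval (m + 5) (m + 4) := by
  have hR : IsSign (A.submatrix (fun i : Fin (m + 3) => i.succ.succ) id) := hA.submatrix _ _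
  have hrk' : (A.submatrix (fun i : Fin (m + 3) => i.succ.succ) id).rank = m + 3 := by
    have h1 := rank_le_rank_deleteRow A
    have h2 := rank_le_rank_deleteRow (A.submatrix Fin.succ id)
    have h3 := rank_le_height (A.submatrix (fun i : Fin (m + 3) => i.succ.succ) id)
    have h4 : (A.submatrix Fin.succ id).submatrix Fin.succ id =
      A.submatrix (fun i : Fin (m + 3) => i.succ.succ) id := rfl
    rw [h4] at h2
    omega
  refine (abs_per_le_of_coloops hA hU hV hrow hrk' (z := m + 1) (fun Z hZ => ?_)
    (by omega)).trans_lt (far_lt m)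
  have hlt := card_coloops_lt hR (by omega) (by omega) hZ
  by_contra! hgt
  have hrank := rank_eq_card_add _ Z hZ
  rw [hrk'] at hrank
  have hcard : 2 < Zᶜ.card := by
    rw [Finset.card_compl, Fintype.card_fin]
    omega
  obtain ⟨a, b, c, ha, hb, hc, hab, hac, hbc⟩ := Finset.two_lt_card_iff.1 hcard
  rw [Finset.mem_compl] at ha hb hc
  exact hcol (hasCloseCols_of_par hA hab hac hbc
    (hR.par_of_finrank_le_one (by omega) (S := (Z : Set (Fin (m + 5)))ᶜ) (by omega) (by simpa)
      (by simpa))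
    (hR.par_of_finrank_le_one (by omega) (S := (Z : Set (Fin (m + 5)))ᶜ) (by omega) (by simpa)
      (by simpa)))

/-- The case of nonsingular matrices. -/
theorem exact_of_nonsingular {A : Matrix (Fin (m + 5)) (Fin (m + 5)) ℚ} (hA : IsSign A)
    (hU : PerBound (m + 3) (m + 1)) (hV : PerBound (m + 3) m) (hB : PerBound (m + 4) (m + 2))
    (hE : ParExtremalStar (m + 4) (m + 2)) (hrk : A.rank = m + 5) :
    |per A| ≤ kval (m + 5) (m + 4) ∧ (|per A| = kval (m + 5) (m + 4) → IsStar (m + 4) A) := by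
  by_cases hcol : HasCloseCols A
  · exact exact_of_hasCloseCols (by omega) hB hE hA hrk hcol
  by_cases hrow : HasCloseCols Aᵀ
  · have := exact_of_hasCloseCols (by omega) hB hE hA.transpose (by rw [rank_transpose, hrk]) hrow
    rw [per_transpose] at this
    exact ⟨this.1, fun h => (this.2 h).transpose⟩
  · have := abs_per_lt_of_not_close hA hU hV hrk (fun ⟨i, s, hs, h⟩ => hrow ⟨i, 0, 1, by simp, s, hs, h⟩) hcol
    exact ⟨this.le, fun h => absurd h this.ne⟩

end Far

/-! ### Small cases -/

section Small

open Module Submodule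

variable {m n r : ℕ}

theorem abs_per_le_factorial {A : Matrix (Fin n) (Fin n) ℚ} (hA : IsSign A) :
    |per A| ≤ kval n 0 := by
  rw [kval_zero]
  refine (Finset.abs_sum_le_sum_abs _ _).trans_eq ?_
  have : ∀ σ : Equiv.Perm (Fin n), |∏ i, A i (σ i)| = 1 := fun σ =>
    IsSignVec.prod_abs fun i => hA i (σ i)
  simp [this, Fintype.card_perm]

theorem perBound_zero (n : ℕ) : PerBound n 0 := fun _ hN _ => abs_per_le_factorial hN

theorem isStar_zero_of_rank {A : Matrix (Fin (n + 1)) (Fin (n + 1)) ℚ} (hA : IsSign A)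
    (h : A.rank = 0 + 1) : IsStar 0 A := by
  refine isStar_zero_of_par hA fun j => ?_
  exact hA.par_of_finrank_le_one (by omega) (S := Set.univ)
    (by rw [finrank_span_cols, h]) (Set.mem_univ _) (Set.mem_univ _)

theorem perBound_of_exact (hn : 3 ≤ n)
    (h : ∀ s, r ≤ s → ∀ N : Matrix (Fin n) (Fin n) ℚ, IsSign N → N.rank = s + 1 →
      |per N| ≤ kval n s) : PerBound n r := by
  intro N hN hr
  have hle := rank_le_width N
  have := h (N.rank - 1) (by omega) N hN (by omega)
  exact this.trans (kval_anti _ _ _ hn (by omega) (by omega))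

theorem exists_perm_pair {i j : Fin (m + 2)} (hij : i ≠ j) :
    ∃ ρ : Equiv.Perm (Fin (m + 2)), ρ 0 = i ∧ ρ 1 = j := by
  obtain ⟨ρ, h0, hs⟩ := exists_perm_cons i
  obtain ⟨k, rfl⟩ := Fin.exists_succAbove_eq hij.symm
  refine ⟨(Equiv.swap 1 k.succ).trans ρ, ?_, ?_⟩
  · rw [Equiv.trans_apply, Equiv.swap_apply_of_ne_of_ne (by simp) (Fin.succ_ne_zero _).symm, h0]
  · rw [Equiv.trans_apply, Equiv.swap_apply_left, hs]

theorem exists_not_par {A : Matrix (Fin m) (Fin n) ℚ} (S : Finset (Fin m)) (h : S.card < A.rank) :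
    ∃ i, ∀ s ∈ S, ¬ Par (A i) (A s) := by
  by_contra! h'
  exact h.not_ge (rank_le_card_of_par A S h')

theorem ne_of_not_par {A : Matrix (Fin m) (Fin n) ℚ} {i j : Fin m} (h : ¬ Par (A i) (A j)) :
    i ≠ j := by
  rintro rfl
  exact h (Par.refl _)

theorem IsClose.exists_exceptional {α : Type*} [DecidableEq α] {u v : α → ℚ} (hu : IsSignVec u)
    (hv : IsSignVec v) (h : IsClose u v) (hp : ¬ Par u v) :
    ∃ (p : α) (s : ℚ), (s = 1 ∨ s = -1) ∧ ∀ l, u l = s * v l * if l = p then -1 else 1 := by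
  obtain ⟨p, s, hs, h⟩ := h
  refine ⟨p, s, hs, fun l => ?_⟩
  split_ifs with hl
  · subst hl
    rcases eq_or_eq_neg_of_sign (hu l) (IsSignVec.mul (fun _ => hs) hv l) with h1 | h1
    · refine absurd ⟨s, hs, fun i => ?_⟩ hp
      by_cases hi : i = l
      · rw [hi, h1]
      · exact h i hi
    · rw [h1]
      ring
  · rw [h l hl, mul_one]

theorem not_isClose_of_isClose (hn : 4 ≤ n) {a b c : Fin n → ℚ} (ha : IsSignVec a)
    (hb : IsSignVec b) (hc : IsSignVec c) (hab : IsClose b a) (hac : IsClose c a)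
    (nab : ¬ Par b a) (nac : ¬ Par c a) (nbc : ¬ Par b c) : ¬ IsClose b c := by
  obtain ⟨p, s, hs, hb'⟩ := hab.exists_exceptional hb ha nab
  obtain ⟨q, t, ht, hc'⟩ := hac.exists_exceptional hc ha nac
  rintro ⟨i, u, hu, h⟩
  have hpq : p ≠ q := by
    rintro rfl
    refine nbc ⟨s * t, IsSignVec.mul (fun _ : Unit => hs) (fun _ => ht) (), fun l => ?_⟩
    rw [hb', hc']
    rcases ht with rfl | rfl <;> ring
  have hss : ∀ {x : ℚ}, x = 1 ∨ x = -1 → x ≠ 0 ∧ x * x = 1 := by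
    rintro x (rfl | rfl) <;> norm_num
  obtain ⟨l, hl⟩ : ∃ l, l ∉ ({p, q, i} : Finset (Fin n)) := by
    by_contra! h
    have h1 := Finset.card_le_three (a := p) (b := q) (c := i)
    rw [Finset.eq_univ_iff_forall.2 h, Finset.card_fin] at h1
    omega
  simp only [Finset.mem_insert, Finset.mem_singleton, not_or] at hl
  have h1 := h l hl.2.2
  rw [hb', hc', if_neg hl.1, if_neg hl.2.1] at h1
  have e1 : s = u * t := mul_right_cancel₀ (hss (ha l)).1 (by linarith)
  by_cases hpi : p = i
  · have h2 := h q (by rw [← hpi]; exact hpq.symm)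
    rw [hb', hc', if_neg hpq.symm, if_pos rfl] at h2
    have e2 : s = -(u * t) := mul_right_cancel₀ (hss (ha q)).1 (by linarith)
    exact (hss hs).1 (by linarith)
  · have h2 := h p hpi
    rw [hb', hc', if_neg hpq, if_pos rfl] at h2
    have e2 : s = -(u * t) := mul_right_cancel₀ (hss (ha p)).1 (by linarith)
    exact (hss hs).1 (by linarith)

/-- Of three pairwise nonparallel rows, two are not close. -/
theorem exists_not_isClose (hn : 4 ≤ n) {A : Matrix (Fin m) (Fin n) ℚ} (hA : IsSign A)
    {a b c : Fin m} (hab : ¬ Par (A b) (A a)) (hac : ¬ Par (A c) (A a)) (hbc : ¬ Par (A b) (A c)) :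
    ∃ i j, i ≠ j ∧ ¬ IsClose (A i) (A j) := by
  by_cases h1 : IsClose (A b) (A a)
  · by_cases h2 : IsClose (A c) (A a)
    · exact ⟨b, c, ne_of_not_par hbc,
        not_isClose_of_isClose hn (hA a) (hA b) (hA c) h1 h2 hab hac hbc⟩
    · exact ⟨c, a, ne_of_not_par hac, h2⟩
  · exact ⟨b, a, ne_of_not_par hab, h1⟩

theorem isStar_of_isClose {R : Matrix (Fin m) (Fin n) ℚ} (hR : IsSign R) {Z : Finset (Fin n)}
    {c : Fin n} (hm : 0 < m) (hpar : ∀ j ∉ Z, Par (Rᵀ j) (Rᵀ c))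
    (hclose : ∀ j ∈ Z, IsClose (Rᵀ j) (Rᵀ c)) (hnc : ∀ j ∈ Z, ¬ Par (Rᵀ j) (Rᵀ c))
    (hZ : ∀ a ∈ Z, ∀ b ∈ Z, a ≠ b → ¬ Par (Rᵀ a) (Rᵀ b)) : IsStar Z.card R := by
  have hexc : ∀ j, ∃ (q : Fin m) (s : ℚ), (s = 1 ∨ s = -1) ∧
      ∀ i, R i j = s * R i c * if j ∈ Z ∧ i = q then -1 else 1 := by
    intro j
    by_cases hj : j ∈ Z
    · obtain ⟨q, s, hs, h⟩ := (hclose j hj).exists_exceptional (hR.transpose j) (hR.transpose c)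
        (hnc j hj)
      exact ⟨q, s, hs, fun i => by simpa [hj] using h i⟩
    · obtain ⟨s, hs, h⟩ := hpar j hj
      exact ⟨⟨0, hm⟩, s, hs, fun i => by simpa [hj] using h i⟩
  choose q s hs h using hexc
  exact isStar_of_exceptional hR c hs h hZ

/-- Two different pairs of parallel rows lower the rank by two. -/
theorem rank_add_two_le {A : Matrix (Fin m) (Fin n) ℚ} {a a' y y' : Fin m} (haa : a ≠ a')
    (hp : Par (A a') (A a)) (hyy : y ≠ y') (hp' : Par (A y) (A y')) (hya : y ≠ a) (hya' : y ≠ a') :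
    A.rank + 2 ≤ m := by
  have hm : 2 ≤ m := by
    have := Finset.card_le_univ {a, a'}
    rwa [Finset.card_pair haa, Fintype.card_fin] at this
  have hcard : ((Finset.univ.erase a').erase y).card = m - 2 := by
    rw [Finset.card_erase_of_mem (by simpa using hya'), Finset.card_erase_of_mem (by simp),
      Finset.card_fin]
    omega
  have := rank_le_card_of_par A ((Finset.univ.erase a').erase y) fun i => by
    by_cases hi : i = a'
    · exact ⟨a, by simp [haa, hya.symm], hi ▸ hp⟩
    by_cases hi' : i = y
    · subst hi'
      by_cases h : y' = a'
      · exact ⟨a, by simp [haa, hya.symm], hp'.trans (h ▸ hp)⟩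
      · exact ⟨y', by simp [h, hyy.symm], hp'⟩
    · exact ⟨i, by simp [hi, hi'], Par.refl _⟩
  omega

theorem kval_three_one : kval 3 1 = 2 := by norm_num [kval, Nat.factorial]
theorem kval_three_two : kval 3 2 = 2 := by norm_num [kval, Nat.factorial]
theorem kval_three_zero : kval 3 0 = 6 := by norm_num [kval, Nat.factorial]
theorem kval_four_two : kval 4 2 = 8 := by norm_num [kval, Nat.factorial]
theorem kval_five_three : kval 5 3 = 32 := by norm_num [kval, Nat.factorial]

theorem abs_per_three {A : Matrix (Fin 3) (Fin 3) ℚ} (hA : IsSign A) (h : 2 ≤ A.rank) :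
    |per A| ≤ 2 := by
  obtain ⟨i, hi⟩ := exists_not_par (A := A) {0} (by simpa)
  have hi := hi 0 (by simp)
  obtain ⟨ρ, h0, h1⟩ := exists_perm_pair (m := 1) (ne_of_not_par hi)
  rw [← per_submatrix ρ (Equiv.refl _)]
  have hB : IsSign (A.submatrix ρ (Equiv.refl _)) := hA.submatrix _ _
  set B := A.submatrix ρ (Equiv.refl _) with hBdef
  have hB0 : B 0 = A i := by rw [← h0]; rfl
  have hB1 : B 1 = A 0 := by rw [← h1]; rfl
  obtain ⟨⟨x, hx⟩, ⟨y, hy⟩⟩ := exists_of_not_par (hA i) (hA 0) hi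
  rw [← hB0, ← hB1] at hx hy
  have h1s : 1 ≤ (Finset.univ.filter fun j => B 0 j = B 1 j).card :=
    Finset.card_pos.2 ⟨x, by simpa using hx⟩
  have h2s : (Finset.univ.filter fun j => B 0 j = B 1 j).card ≤ 2 := by
    have : (Finset.univ.filter fun j => B 0 j = B 1 j) ⊆ Finset.univ.erase y := by
      intro z hz
      simp only [Finset.mem_filter, Finset.mem_univ, true_and] at hz
      refine Finset.mem_erase.2 ⟨?_, Finset.mem_univ _⟩
      rintro rfl
      have := hB.sq 1 z
      rw [hy] at hz
      have h3 : B 1 z = 0 := by linarith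
      rw [h3] at this
      norm_num at this
    refine (Finset.card_le_card this).trans ?_
    simp
  obtain ⟨t, ht⟩ := Nat.exists_eq_add_of_le (h2s.trans (by norm_num : 2 ≤ 3))
  refine (abs_per_le_of_pair (m := 1) hB ∅ (U := 1) (V := 0) le_rfl (fun j k => ?_) _ t rfl
    ht.symm).trans ?_
  · have := abs_per_le_factorial (hB.submatrix (fun i : Fin 1 => i.succ.succ)
      fun i => j.succAbove (k.succAbove i))
    rw [kval_zero] at this
    simpa using this
  · generalize (Finset.univ.filter fun j => B 0 j = B 1 j).card = s at *
    obtain ⟨rfl, rfl⟩ | ⟨rfl, rfl⟩ : (s = 1 ∧ t = 2) ∨ (s = 2 ∧ t = 1) := by omega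
    all_goals norm_num

theorem perBound_three (r : ℕ) (hr : r ≤ 2) : PerBound 3 r := by
  intro N hN hrk
  obtain rfl | rfl | rfl : r = 0 ∨ r = 1 ∨ r = 2 := by omega
  · exact abs_per_le_factorial hN
  · rw [kval_three_one]
    exact abs_per_three hN (by omega)
  · rw [kval_three_two]
    exact abs_per_three hN (by omega)

theorem isClose_of_three {u v : Fin 3 → ℚ} (hu : IsSignVec u) (hv : IsSignVec v) :
    IsClose u v := by
  by_contra h
  obtain ⟨s, t, -, hst, hs, ht⟩ := exists_card_of_not_isClose (by norm_num) hu hv h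
  omega

theorem parExtremalStar_three (r : ℕ) (hr : r ≤ 1) : ParExtremalStar 3 r := by
  intro N hN hrk _ ⟨j, k, hjk, hp⟩
  obtain rfl | rfl : r = 0 ∨ r = 1 := by omega
  · exact isStar_zero_of_rank hN hrk
  obtain ⟨l, hl⟩ : ∃ l, ({j, k} : Finset (Fin 3))ᶜ = {l} := by
    rw [← Finset.card_eq_one, Finset.card_compl, Finset.card_pair hjk, Fintype.card_fin]
  have hmem : ∀ i, i = l ↔ i ≠ j ∧ i ≠ k := fun i => by
    rw [← Finset.mem_singleton, ← hl]
    simp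
  have hnot : ¬ Par (Nᵀ l) (Nᵀ j) := fun h => by
    have := rank_le_card_of_par Nᵀ {j} fun i => by
      refine ⟨j, by simp, ?_⟩
      by_cases h1 : i = l
      · rwa [h1]
      · by_cases h2 : i = j
        · rw [h2]; exact Par.refl _
        · have : i = k := by
            by_contra h3
            exact h1 ((hmem i).2 ⟨h2, h3⟩)
          rw [this]; exact hp.symm
    rw [rank_transpose, hrk] at this
    simp at this
  rw [← Finset.card_singleton l]
  refine isStar_of_isClose hN (c := j) (by norm_num) (fun i hi => ?_) (fun i _ => ?_)
    (fun i hi => ?_) (fun a ha b hb hab => ?_)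
  · rw [Finset.mem_singleton, hmem] at hi
    by_cases h2 : i = j
    · rw [h2]; exact Par.refl _
    · have : i = k := by
        by_contra h3
        exact hi ⟨h2, h3⟩
      rw [this]; exact hp.symm
  · exact isClose_of_three (hN.transpose _) (hN.transpose _)
  · rw [Finset.mem_singleton.1 hi]
    exact hnot
  · exact absurd ((Finset.mem_singleton.1 ha).trans (Finset.mem_singleton.1 hb).symm) hab

theorem abs_per_four {A : Matrix (Fin 4) (Fin 4) ℚ} (hA : IsSign A) (h : 3 ≤ A.rank) :
    |per A| ≤ 8 := by
  obtain ⟨b, hb⟩ := exists_not_par (A := A) {0} (by simp; omega)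
  obtain ⟨c, hc⟩ := exists_not_par (A := A) {0, b} (Finset.card_le_two.trans_lt (by omega))
  obtain ⟨i, j, hij, hnc⟩ := exists_not_isClose le_rfl hA (hb 0 (by simp)) (hc 0 (by simp))
    (fun h => hc b (by simp) h.symm)
  obtain ⟨ρ, h0, h1⟩ := exists_perm_pair (m := 2) hij
  rw [← per_submatrix ρ (Equiv.refl _)]
  have hB : IsSign (A.submatrix ρ (Equiv.refl _)) := hA.submatrix _ _
  set B := A.submatrix ρ (Equiv.refl _) with hBdef
  have hB0 : B 0 = A i := by rw [← h0]; rfl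
  have hB1 : B 1 = A j := by rw [← h1]; rfl
  rw [← hB0, ← hB1] at hnc
  obtain ⟨s, t, hs, hst, h2s, h2t⟩ :=
    exists_card_of_not_isClose (by norm_num) (hB 0) (hB 1) hnc
  obtain ⟨rfl, rfl⟩ : s = 2 ∧ t = 2 := by omega
  refine (abs_per_le_of_pair (m := 2) hB ∅ (U := 2) (V := 0) le_rfl (fun j k => ?_) 2 2 hs
    rfl).trans (by norm_num)
  have := abs_per_le_factorial (hB.submatrix (fun i : Fin 2 => i.succ.succ)
      fun i => j.succAbove (k.succAbove i))
  rw [kval_zero] at this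
  simpa using this

theorem perBound_four_two : PerBound 4 2 := fun N hN hrk => by
  rw [kval_four_two]
  exact abs_per_four hN hrk

theorem per_four_of_rows {A : Matrix (Fin 4) (Fin 4) ℚ} {s : ℚ} (h0 : ∀ j, A 0 j = 1)
    (h1 : ∀ j, A 1 j = s) :
    per A = 2 * s * ((∑ j, A 2 j) * (∑ j, A 3 j) - ∑ j, A 2 j * A 3 j) := by
  have h (B : Matrix (Fin 0) (Fin 0) ℚ) : per B = 1 := by simp [per]
  simp only [per_succ_row, Fin.sum_univ_succ, submatrix_apply, h, h0, h1, Fin.isValue,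
    Finset.univ_eq_empty, Finset.sum_empty, Fin.succAbove, Fin.succ_zero_eq_one, Fin.succ_one_eq_two]
  simp [Fin.lt_def, Fin.succ, Fin.castSucc]
  ring

end Small

/-! ### Orders four and five -/

section FourFive

open Module Submodule

variable {m n r : ℕ}

theorem sum_mul_eq_zero_of_card {u v : Fin n → ℚ} (hu : IsSignVec u) (hv : IsSignVec v) {s : ℕ}
    (hs : (Finset.univ.filter fun j => u j = v j).card = s) (hn : s + s = n) :
    ∑ j, v j * u j = 0 := by
  have h (j) : v j * u j = if u j = v j then 1 else -1 := by
    rcases hu j with h1 | h1 <;> rcases hv j with h2 | h2 <;> norm_num [h1, h2]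
  have hc := Finset.card_filter_add_card_filter_not (s := Finset.univ) fun j => u j = v j
  rw [hs, Finset.card_fin] at hc
  simp only [h, Finset.sum_ite, Finset.sum_const, hs]
  rw [show (Finset.univ.filter fun j => ¬ u j = v j).card = s by omega]
  simp

theorem par_of_abs_per_four {A : Matrix (Fin 4) (Fin 4) ℚ} (hA : IsSign A)
    (hp : Par (A 1) (A 0)) (hnc : ¬ IsClose (A 2) (A 0) ∨ ¬ IsClose (A 3) (A 0))
    (hper : |per A| = 8) : Par (A 2) (A 3) := by
  obtain ⟨s, hs, h1⟩ := hp
  have hB : |per fun i j => 1 * A 0 j * A i j| = |per A| :=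
    abs_per_scale (ε := fun _ => 1) (fun _ => Or.inl rfl) (hA 0) A
  have hrows : per (fun i j => 1 * A 0 j * A i j) = _ :=
    per_four_of_rows (s := s) (fun j => by rw [one_mul, hA.sq])
      (fun j => by rw [one_mul, h1 j, mul_left_comm, hA.sq, mul_one])
  rw [← hB, hrows] at hper
  have key (i) (h : ¬ IsClose (A i) (A 0)) : ∑ j, 1 * A 0 j * A i j = 0 := by
    obtain ⟨s, t, hs, hst, h2s, h2t⟩ := exists_card_of_not_isClose (by norm_num) (hA i) (hA 0) h
    simp only [one_mul]
    exact sum_mul_eq_zero_of_card (hA i) (hA 0) hs (by omega)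
  have hz : (∑ j, 1 * A 0 j * A 2 j) * (∑ j, 1 * A 0 j * A 3 j) = 0 := by
    rcases hnc with h | h
    · rw [key 2 h, zero_mul]
    · rw [key 3 h, mul_zero]
  have hprod (j) : 1 * A 0 j * A 2 j * (1 * A 0 j * A 3 j) = A 2 j * A 3 j := by
    linear_combination A 2 j * A 3 j * hA.sq 0 j
  simp only [hz, hprod, zero_sub] at hper
  rw [abs_mul, abs_neg] at hper
  have h2 : |2 * s| = 2 := by rcases hs with rfl | rfl <;> norm_num
  rw [h2] at hper
  have h4 : |∑ j, A 2 j * A 3 j * 1| = ∑ j : Fin 4, (1 : ℚ) := by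
    simp only [mul_one, Finset.sum_const, Finset.card_fin, nsmul_eq_mul]
    norm_num
    linarith
  obtain ⟨e, he, h⟩ := eq_of_abs_sum_eq (IsSignVec.mul (hA 2) (hA 3)) (fun _ _ => one_pos) h4
  exact ⟨e, he, fun j => by
    have := h j (Finset.mem_univ _)
    linear_combination A 3 j * this - A 2 j * hA.sq 3 j⟩

theorem isStar_or_exists_not_isClose {M : Matrix (Fin n) (Fin n) ℚ} (hM : IsSign M)
    (hrk : M.rank + 1 = n) {a a' : Fin n} (haa : a ≠ a') (hp : Par (M a') (M a)) :
    IsStar (n - 2) M ∨ ∃ y, y ≠ a ∧ y ≠ a' ∧ ¬ IsClose (M y) (M a) := by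
  by_cases hc : ∃ y, y ≠ a ∧ y ≠ a' ∧ ¬ IsClose (M y) (M a)
  · exact Or.inr hc
  push Not at hc
  left
  have hnp : ∀ y y', y ≠ y' → y ≠ a → y ≠ a' → ¬ Par (M y) (M y') := fun y y' hyy h1 h2 h => by
    have := rank_add_two_le haa hp hyy h h1 h2
    omega
  have hmem (j) : j ∈ ({a, a'} : Finset (Fin n))ᶜ ↔ j ≠ a ∧ j ≠ a' := by simp
  have hcard : ({a, a'} : Finset (Fin n))ᶜ.card = n - 2 := by
    rw [Finset.card_compl, Finset.card_pair haa, Fintype.card_fin]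
  rw [← hcard, ← M.transpose_transpose]
  refine IsStar.transpose (isStar_of_isClose (c := a) hM.transpose (by omega) (fun j hj => ?_)
    (fun j hj => ?_) (fun j hj => ?_) (fun j hj k _ hjk => ?_))
  · by_cases h : j = a
    · rw [h]
      exact Par.refl _
    · have : j = a' := by
        by_contra h'
        exact hj ((hmem j).2 ⟨h, h'⟩)
      rw [this]
      exact hp
  all_goals rw [hmem] at hj
  · exact hc j hj.1 hj.2
  · exact hnp j a hj.1 hj.1 hj.2
  · exact hnp j k hjk hj.1 hj.2

theorem parExtremalStar_four_two : ParExtremalStar 4 2 := by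
  rintro N hN hrk hper ⟨a, a', haa, hp⟩
  have hT : Nᵀ.rank = 3 := by rw [rank_transpose, hrk]
  rw [kval_four_two, ← per_transpose] at hper
  rw [← N.transpose_transpose]
  refine IsStar.transpose ?_
  rcases isStar_or_exists_not_isClose hN.transpose (by omega) haa hp.symm with h | ⟨y, h1, h2, hy⟩
  · exact h
  exfalso
  obtain ⟨ρ, h0, h1'⟩ := exists_perm_pair (m := 2) haa
  have hB := hN.transpose.submatrix ρ (Equiv.refl (Fin 4))
  obtain ⟨k, rfl⟩ := ρ.surjective y
  have hk0 : k ≠ 0 := fun h => h1 (by rw [h, h0])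
  have hk1 : k ≠ 1 := fun h => h2 (by rw [h, h1'])
  have := par_of_abs_per_four hB
    (show Par (Nᵀ (ρ 1)) (Nᵀ (ρ 0)) by rw [h0, h1']; exact hp.symm) (by
      change ¬ IsClose (Nᵀ (ρ 2)) (Nᵀ (ρ 0)) ∨ ¬ IsClose (Nᵀ (ρ 3)) (Nᵀ (ρ 0))
      rw [h0]
      obtain rfl | rfl := (by decide : ∀ k : Fin 4, k ≠ 0 → k ≠ 1 → k = 2 ∨ k = 3) k hk0 hk1
      · exact Or.inl hy
      · exact Or.inr hy) (by rw [per_submatrix ρ (Equiv.refl _), hper])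
  have hle := rank_add_two_le (A := Nᵀ) haa hp.symm (y := ρ 2) (y' := ρ 3)
    (fun h => absurd (ρ.injective h) (by decide)) this
    (fun h => absurd (ρ.injective (h.trans h0.symm)) (by decide))
    (fun h => absurd (ρ.injective (h.trans h1'.symm)) (by decide))
  omega

theorem abs_per_five_of_not_isClose {A : Matrix (Fin 5) (Fin 5) ℚ} (hA : IsSign A) {i j : Fin 5}
    (hij : i ≠ j) (hnc : ¬ IsClose (A i) (A j))
    (hnp : ∀ k l, k ≠ l → k ≠ i → k ≠ j → l ≠ i → l ≠ j → ¬ Par (A k) (A l)) : |per A| ≤ 24 := by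
  obtain ⟨ρ, h0, h1⟩ := exists_perm_pair (m := 3) hij
  rw [← per_submatrix ρ (Equiv.refl _)]
  have hB : IsSign (A.submatrix ρ (Equiv.refl _)) := hA.submatrix _ _
  have hR := hB.submatrix (fun i : Fin 3 => i.succ.succ) id
  have hne (k : Fin 3) : ρ k.succ.succ ≠ i ∧ ρ k.succ.succ ≠ j := by
    rw [← h0, ← h1, ρ.injective.ne_iff, ρ.injective.ne_iff]
    exact ⟨Fin.succ_ne_zero _, fun h => Fin.succ_ne_zero k (Fin.succ_injective _ h)⟩
  refine (abs_per_le_of_coloops (m := 0) (z := 2) hB (perBound_three 1 (by norm_num))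
    (perBound_zero 3) ?_ ?_ (fun Z hZ => ?_) (by norm_num)).trans ?_
  · change ¬ IsClose (A (ρ 0)) (A (ρ 1))
    rwa [h0, h1]
  · refine rank_eq_three hR fun k l hkl => ?_
    exact hnp _ _ (fun h => hkl (by simpa using ρ.injective h)) (hne k).1 (hne k).2 (hne l).1
      (hne l).2
  · exact Nat.le_of_lt_succ (card_coloops_lt hR (by norm_num) (by norm_num) hZ)
  · norm_num [kval_three_one, kval_three_zero]

theorem exact_five_three {A : Matrix (Fin 5) (Fin 5) ℚ} (hA : IsSign A) (hrk : A.rank = 4) :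
    |per A| ≤ kval 5 3 ∧ (|per A| = kval 5 3 → IsStar 3 A) := by
  rw [kval_five_three]
  have hsmall (h : |per A| ≤ 24) : |per A| ≤ 32 ∧ (|per A| = 32 → IsStar 3 A) :=
    ⟨by linarith, fun h' => by linarith⟩
  by_cases hpar : ∃ a a', a ≠ a' ∧ Par (A a') (A a)
  · obtain ⟨a, a', haa, hp⟩ := hpar
    rcases isStar_or_exists_not_isClose hA (by omega) haa hp with h | ⟨y, h1, h2, hy⟩
    · rw [IsStar.stdEquiv h |>.abs_per, per_Dmat 5 _ (by norm_num), kval_five_three]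
      exact ⟨by norm_num, fun _ => h⟩
    · refine hsmall (abs_per_five_of_not_isClose hA h1 hy fun k l hkl _ h4 _ h6 h => ?_)
      by_cases hk : k = a'
      · have := rank_add_two_le haa hp hkl.symm h.symm h6 fun e => hkl (hk.trans e.symm)
        omega
      · have := rank_add_two_le haa hp hkl h h4 hk
        omega
  · push Not at hpar
    obtain ⟨i, j, hij, h⟩ := exists_not_isClose (a := 0) (b := 1) (c := 2) (by norm_num) hA
      (hpar _ _ (by decide)) (hpar _ _ (by decide)) (hpar _ _ (by decide))
    exact hsmall (abs_per_five_of_not_isClose hA hij h fun k l hkl _ _ _ _ => hpar _ _ hkl.symm)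

end FourFive

/-! ### The induction on the order -/

section Induction

variable {n r : ℕ}

/-- The facts about matrices of order `n` used at orders `n + 1` and `n + 2`. -/
def SubBounds (n : ℕ) : Prop :=
  (∀ r, r + 1 ≤ n → (n, r) ≠ (4, 3) → PerBound n r) ∧ ∀ r, r + 2 ≤ n → ParExtremalStar n r

/-- The bound of order `n` together with its equality case. -/
def ExactBound (n r : ℕ) : Prop :=
  ∀ A : Matrix (Fin n) (Fin n) ℚ, IsSign A → A.rank = r + 1 →
    |per A| ≤ kval n r ∧ (|per A| = kval n r → IsStar r A)

theorem exactBound_zero (n : ℕ) : ExactBound (n + 1) 0 := fun _ hA hrk =>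
  ⟨abs_per_le_factorial hA, fun _ => isStar_zero_of_rank hA hrk⟩

theorem ExactBound.parExtremalStar (h : ExactBound n r) : ParExtremalStar n r :=
  ExtremalStar.par fun A hA hrk => (h A hA hrk).2

theorem subBounds_of_exactBound (hn : 5 ≤ n) (h : ∀ r, r + 1 ≤ n → ExactBound n r) :
    SubBounds n := by
  refine ⟨fun r _ _ => perBound_of_exact (by omega) fun s _ N hN hs => ?_,
    fun r hr => (h r (by omega)).parExtremalStar⟩
  have := rank_le_width N
  exact (h s (by omega) N hN hs).1

theorem SubBounds.exactBound_succ (hn : 4 ≤ n) (h : SubBounds n) (hr : 1 ≤ r) (hrn : r + 1 ≤ n)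
    (hne : (n, r) ≠ (4, 3)) : ExactBound (n + 1) r := fun A hA hrk => by
  refine exact_of_rank_le (by omega) hr hrn (h.1 r hrn hne)
    (h.1 (r - 1) (by omega) (by simp; omega)) (h.2 (r - 1) (by omega))
    (fun _ => h.2 1 (by omega)) ?_ hA hrk
  have := kval_lt n (r - 1) hn (by omega)
  rwa [Nat.sub_add_cancel hr] at this

theorem exactBound_four_one : ExactBound 4 1 := fun _ hA hrk =>
  exact_of_rank_le le_rfl le_rfl (by norm_num) (perBound_three 1 (by norm_num)) (perBound_zero 3)
    (parExtremalStar_three 0 (by norm_num)) (fun _ => parExtremalStar_three 1 le_rfl)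
    (by norm_num [kval_three_one, kval_three_zero]) hA hrk

theorem subBounds_three : SubBounds 3 :=
  ⟨fun r hr _ => perBound_three r (by omega), fun r hr => parExtremalStar_three r (by omega)⟩

theorem subBounds_four : SubBounds 4 := by
  constructor
  · intro r hr hne
    obtain rfl | rfl | rfl : r = 0 ∨ r = 1 ∨ r = 2 := by
      have : r ≠ 3 := fun h => hne (by rw [h])
      omega
    · exact perBound_zero 4
    · intro N hN hrk
      by_cases h : N.rank = 2
      · exact (exactBound_four_one N hN h).1
      · exact (perBound_four_two N hN (by omega)).trans
          (kval_anti 4 1 2 (by norm_num) (by norm_num) (by norm_num))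
    · exact perBound_four_two
  · intro r hr
    obtain rfl | rfl | rfl : r = 0 ∨ r = 1 ∨ r = 2 := by omega
    · exact (exactBound_zero 3).parExtremalStar
    · exact exactBound_four_one.parExtremalStar
    · exact parExtremalStar_four_two

theorem exactBound_of_subBounds (h : SubBounds (n + 3)) (h' : SubBounds (n + 4))
    (hr : r + 1 ≤ n + 5) : ExactBound (n + 5) r := by
  rcases Nat.eq_zero_or_pos r with rfl | hr0
  · exact exactBound_zero (n + 4)
  by_cases hrn : r = n + 4
  · subst hrn
    exact fun A hA hrk => exact_of_nonsingular hA (h.1 _ (by omega) (by simp; omega))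
      (h.1 _ (by omega) (by simp; omega)) (h'.1 _ (by omega) (by simp; omega)) (h'.2 _ (by omega)) hrk
  by_cases hne : (n + 4, r) = (4, 3)
  · obtain ⟨h1, rfl⟩ := Prod.mk.inj hne
    obtain rfl : n = 0 := by omega
    exact fun A hA hrk => exact_five_three hA hrk
  · exact h'.exactBound_succ (by omega) hr0 (by omega) hne

theorem subBounds (n : ℕ) : SubBounds (n + 3) ∧ SubBounds (n + 4) := by
  induction n with
  | zero => exact ⟨subBounds_three, subBounds_four⟩
  | succ n ih =>
    refine ⟨ih.2, ?_⟩
    rw [show n + 1 + 4 = n + 5 by omega]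
    exact subBounds_of_exactBound (by omega) fun r hr => exactBound_of_subBounds ih.1 ih.2 hr

/-- Kräuter's bound for sign matrices of given rank, with its equality case. -/
theorem exactBound (hn : 5 ≤ n) (hr : r + 1 ≤ n) : ExactBound n r := by
  obtain ⟨n, rfl⟩ := Nat.exists_eq_add_of_le' hn
  exact exactBound_of_subBounds (subBounds n).1 (subBounds n).2 hr

end Induction

theorem krauter_equality_case (n r : ℕ) (hn : 5 ≤ n) (hr : r ≤ n - 1)
    (A : Matrix (Fin n) (Fin n) ℚ) (hA : ∀ i j, A i j = 1 ∨ A i j = -1)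
    (hrk : A.rank = r + 1) :
    |per A| = per (Dmat n r) ↔ StdEquiv A (Dmat n r) := by
  have hD : per (Dmat n r) = kval n r := per_Dmat n r (by omega)
  constructor
  · intro h
    exact ((exactBound hn (by omega) A hA hrk).2 (h.trans hD)).stdEquiv
  · intro h
    rw [h.abs_per, hD, abs_of_pos (kval_pos n r (by omega) (by omega))]
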